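/- Let 0 < α ≤ β < 1 ≤ λ be reals. For every ε > 0 there exists T₀ such that for every real T ≥ T₀, the number of primes p ≤ T for which the number of prime divisors q of p−1 with q ≥ T^α exceeds 2λ·log(β/α)/(1−β) + 1/β is at most (1/λ + ε)·π(T). -/

import Mathlib

open Finset in
theorem sum_moebius_divisors_filter_dvd {k l : ℕ} (hk : Squarefree k) (hl : l ∣ k) :
    ∑ d ∈ k.divisors with l ∣ d, (ArithmeticFunction.moebius d : ℝ) =
      if l = k then (ArithmeticFunction.moebius l : ℝ) else 0 := by
  obtain ⟨m, rfl⟩ := hl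
  have hlm : l * m ≠ 0 := hk.ne_zero
  have hl0 : l ≠ 0 := left_ne_zero_of_mul hlm
  have hm0 : m ≠ 0 := right_ne_zero_of_mul hlm
  obtain ⟨hcop, -, -⟩ := Nat.squarefree_mul_iff.mp hk
  have hset : (l * m).divisors.filter (l ∣ ·) = m.divisors.image (l * ·) := by
    ext d
    simp only [mem_filter, Nat.mem_divisors, mem_image]
    constructor
    · rintro ⟨⟨hd, -⟩, e, rfl⟩
      exact ⟨e, ⟨Nat.dvd_of_mul_dvd_mul_left (Nat.pos_of_ne_zero hl0) hd, hm0⟩, rfl⟩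
    · rintro ⟨e, ⟨he, -⟩, rfl⟩
      exact ⟨⟨Nat.mul_dvd_mul_left l he, hlm⟩, dvd_mul_right l e⟩
  rw [hset, sum_image fun a _ b _ h => Nat.eq_of_mul_eq_mul_left (Nat.pos_of_ne_zero hl0) h]
  have hmul : ∀ e ∈ m.divisors, (ArithmeticFunction.moebius (l * e) : ℝ) =
      ArithmeticFunction.moebius l * ArithmeticFunction.moebius e := fun e he => by
    rw [ArithmeticFunction.isMultiplicative_moebius.map_mul_of_coprime
      (hcop.coprime_dvd_right (Nat.dvd_of_mem_divisors he))]
    push_cast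
    rfl
  rw [sum_congr rfl hmul, ← mul_sum]
  have hsum : ∑ e ∈ m.divisors, (ArithmeticFunction.moebius e : ℝ) = if m = 1 then 1 else 0 := by
    have h := congrArg (fun f : ArithmeticFunction ℤ => f m)
      ArithmeticFunction.moebius_mul_coe_zeta
    simp only [ArithmeticFunction.coe_mul_zeta_apply, ArithmeticFunction.one_apply] at h
    exact_mod_cast h
  rw [hsum]
  by_cases hm : m = 1
  · simp [hm]
  · have : l ≠ l * m := fun h => hm (by
      have : l * 1 = l * m := by simpa using h
      exact (Nat.eq_of_mul_eq_mul_left (Nat.pos_of_ne_zero hl0) this).symm)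
    simp [hm, this]

/-- The main factor `∑ 1 / φ(l)` of Selberg's upper bound sieve with sifting divisors `D`. -/
noncomputable def selbergMass (D : Finset ℕ) : ℝ := ∑ l ∈ D, 1 / (Nat.totient l : ℝ)

/-- Selberg's optimal weights for the sifting divisors `D`. -/
noncomputable def selbergWeight (D : Finset ℕ) (d : ℕ) : ℝ :=
  ArithmeticFunction.moebius d * d / selbergMass D *
    ∑ l ∈ D with d ∣ l, 1 / (Nat.totient l : ℝ)

section Selberg

open Finset

variable {D : Finset ℕ}

theorem selbergMass_pos (h1 : 1 ∈ D) : 0 < selbergMass D :=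
  lt_of_lt_of_le (by norm_num) (single_le_sum (f := fun l : ℕ => 1 / (Nat.totient l : ℝ))
    (fun _ _ => by positivity) h1)

theorem selbergWeight_one (h1 : 1 ∈ D) : selbergWeight D 1 = 1 := by
  have := (selbergMass_pos h1).ne'
  simp only [selbergWeight, one_dvd, filter_true]
  rw [← selbergMass]
  simp [this]

theorem sum_selbergWeight_div (hsq : ∀ d ∈ D, Squarefree d)
    (hdvd : ∀ d ∈ D, ∀ e, e ∣ d → e ∈ D) {l : ℕ} (hl : l ∈ D) :
    ∑ d ∈ D with l ∣ d, selbergWeight D d / d =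
      ArithmeticFunction.moebius l / (Nat.totient l * selbergMass D) := by
  have hterm : ∀ d ∈ D.filter (l ∣ ·), selbergWeight D d / d =
      ∑ k ∈ D, if d ∣ k then
        (1 / selbergMass D) * (1 / (Nat.totient k : ℝ)) * ArithmeticFunction.moebius d else 0 := by
    intro d hd
    have hd0 : (d : ℝ) ≠ 0 := by exact_mod_cast (hsq d (mem_filter.mp hd).1).ne_zero
    rw [← sum_filter, ← sum_mul, ← mul_sum, selbergWeight]
    field_simp
  rw [sum_congr rfl hterm, sum_comm]
  have hinner : ∀ k ∈ D, (∑ d ∈ D with l ∣ d, if d ∣ k then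
        (1 / selbergMass D) * (1 / (Nat.totient k : ℝ)) * ArithmeticFunction.moebius d else 0) =
      if l = k then (1 / selbergMass D) * (1 / (Nat.totient k : ℝ)) *
        ArithmeticFunction.moebius l else 0 := by
    intro k hk
    have hset : (D.filter (l ∣ ·)).filter (· ∣ k) = k.divisors.filter (l ∣ ·) := by
      ext d
      simp only [mem_filter, Nat.mem_divisors]
      exact ⟨fun h => ⟨⟨h.2, (hsq k hk).ne_zero⟩, h.1.2⟩,
        fun h => ⟨⟨hdvd k hk d h.1.1, h.2⟩, h.1.1⟩⟩
    rw [← sum_filter, hset, ← mul_sum]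
    by_cases hlk : l ∣ k
    · rw [sum_moebius_divisors_filter_dvd (hsq k hk) hlk]
      split_ifs <;> simp
    · have hne : l ≠ k := fun h => hlk (h ▸ dvd_rfl)
      rw [if_neg hne, filter_false_of_mem, sum_empty, mul_zero]
      exact fun d hd hld => hlk (hld.trans (Nat.dvd_of_mem_divisors hd))
  rw [sum_congr rfl hinner, sum_ite_eq, if_pos hl]
  field_simp

theorem sum_totient_filter_dvd (hdvd : ∀ d ∈ D, ∀ e, e ∣ d → e ∈ D) {a b : ℕ} (ha : a ∈ D)
    (ha0 : a ≠ 0) :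
    ∑ l ∈ D with l ∣ a ∧ l ∣ b, (Nat.totient l : ℝ) = (a.gcd b : ℕ) := by
  have hset : D.filter (fun l => l ∣ a ∧ l ∣ b) = (a.gcd b).divisors := by
    ext l
    simp only [mem_filter, Nat.mem_divisors, Nat.dvd_gcd_iff]
    exact ⟨fun h => ⟨h.2, Nat.gcd_ne_zero_left ha0⟩, fun h => ⟨hdvd a ha l h.1.1, h.1⟩⟩
  rw [hset]
  exact_mod_cast Nat.sum_totient _

theorem selberg_quadratic_form (h1 : 1 ∈ D) (hsq : ∀ d ∈ D, Squarefree d)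
    (hdvd : ∀ d ∈ D, ∀ e, e ∣ d → e ∈ D) :
    ∑ a ∈ D, ∑ b ∈ D, selbergWeight D a * selbergWeight D b / (a.lcm b : ℕ) =
      1 / selbergMass D := by
  have hS := (selbergMass_pos h1).ne'
  have hexp : ∀ a ∈ D, ∀ b ∈ D, selbergWeight D a * selbergWeight D b / (a.lcm b : ℕ) =
      ∑ l ∈ D, (Nat.totient l : ℝ) * ((if l ∣ a then selbergWeight D a / a else 0) *
        (if l ∣ b then selbergWeight D b / b else 0)) := by
    intro a ha b hb
    have ha0 := (hsq a ha).ne_zero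
    have hb0 := (hsq b hb).ne_zero
    have hgl : ((a.gcd b : ℕ) : ℝ) * (a.lcm b : ℕ) = a * b := by exact_mod_cast Nat.gcd_mul_lcm a b
    have hl0 : ((a.lcm b : ℕ) : ℝ) ≠ 0 := by exact_mod_cast Nat.lcm_ne_zero ha0 hb0
    have ha0' : (a : ℝ) ≠ 0 := by exact_mod_cast ha0
    have hb0' : (b : ℝ) ≠ 0 := by exact_mod_cast hb0
    have hsum : ∑ l ∈ D, (Nat.totient l : ℝ) * ((if l ∣ a then selbergWeight D a / a else 0) *
        (if l ∣ b then selbergWeight D b / b else 0)) =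
        ∑ l ∈ D with l ∣ a ∧ l ∣ b, (Nat.totient l : ℝ) *
          (selbergWeight D a / a * (selbergWeight D b / b)) := by
      rw [sum_filter]
      refine sum_congr rfl fun l _ => ?_
      by_cases h : l ∣ a <;> by_cases h' : l ∣ b <;> simp [h, h']
    rw [hsum, ← sum_mul, sum_totient_filter_dvd hdvd ha ha0]
    rw [div_mul_div_comm, ← hgl]
    have hg0 : ((a.gcd b : ℕ) : ℝ) ≠ 0 := by exact_mod_cast Nat.gcd_ne_zero_left ha0
    field_simp
  rw [sum_congr rfl fun a ha => sum_congr rfl (hexp a ha)]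
  rw [sum_congr rfl fun a _ => sum_comm]
  have hsq_form : ∀ l ∈ D, ∑ a ∈ D, ∑ b ∈ D, (Nat.totient l : ℝ) *
      ((if l ∣ a then selbergWeight D a / a else 0) *
        (if l ∣ b then selbergWeight D b / b else 0)) =
      1 / (Nat.totient l : ℝ) * (1 / selbergMass D ^ 2) := by
    intro l hl
    have hφ : (Nat.totient l : ℝ) ≠ 0 := by
      exact_mod_cast (Nat.totient_pos.mpr (Nat.pos_of_ne_zero (hsq l hl).ne_zero)).ne'
    have hμ : (ArithmeticFunction.moebius l : ℝ) ^ 2 = 1 := by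
      exact_mod_cast ArithmeticFunction.moebius_sq_eq_one_of_squarefree (hsq l hl)
    simp_rw [← mul_sum]
    rw [← sum_mul, ← sum_filter, sum_selbergWeight_div hsq hdvd hl]
    field_simp
    exact hμ
  rw [sum_comm, sum_congr rfl hsq_form, ← sum_mul, ← selbergMass]
  field_simp

theorem mul_sum_filter_dvd_le_selbergMass (hsq : ∀ d ∈ D, Squarefree d)
    (hdvd : ∀ d ∈ D, ∀ e, e ∣ d → e ∈ D) {d : ℕ} (hd : d ∈ D) :
    d * ∑ l ∈ D with d ∣ l, 1 / (Nat.totient l : ℝ) ≤ selbergMass D := by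
  have hd0 : 0 < d := Nat.pos_of_ne_zero (hsq d hd).ne_zero
  set f : ℕ × ℕ → ℕ := fun x => x.1 * (x.2 / d) with hf
  have hspec : ∀ x ∈ d.divisors ×ˢ D.filter (d ∣ ·), ∃ k m, x.1 = k ∧ x.2 = d * m ∧ k ∣ d ∧
      d * m ∈ D ∧ d.Coprime m ∧ k.Coprime m ∧ f x = k * m := by
    rintro ⟨k, l⟩ hx
    simp only [mem_product, Nat.mem_divisors, mem_filter] at hx
    obtain ⟨⟨hk, -⟩, hl, m, rfl⟩ := hx
    have hc := (Nat.squarefree_mul_iff.mp (hsq _ hl)).1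
    exact ⟨k, m, rfl, rfl, hk, hl, hc, hc.coprime_dvd_left hk, by
      simp [hf, Nat.mul_div_cancel_left m hd0]⟩
  have hinj : Set.InjOn f (d.divisors ×ˢ D.filter (d ∣ ·) : Finset (ℕ × ℕ)) := by
    intro x hx y hy hxy
    obtain ⟨k, m, hx1, hx2, hk, -, hcm, hkm, hfx⟩ := hspec x hx
    obtain ⟨k', m', hy1, hy2, hk', -, hcm', hkm', hfy⟩ := hspec y hy
    have h : k * m = k' * m' := by rw [← hfx, hxy, hfy]
    have hkk : k = k' := by
      apply Nat.dvd_antisymm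
      · exact (hcm'.coprime_dvd_left hk).dvd_of_dvd_mul_right (h ▸ dvd_mul_right k m)
      · exact (hcm.coprime_dvd_left hk').dvd_of_dvd_mul_right (h ▸ dvd_mul_right k' m')
    subst hkk
    have hmm := Nat.eq_of_mul_eq_mul_left (Nat.pos_of_dvd_of_pos hk hd0) h
    subst hmm
    exact Prod.ext (hx1.trans hy1.symm) (hx2.trans hy2.symm)
  have hφd : (Nat.totient d : ℝ) ≠ 0 := by exact_mod_cast (Nat.totient_pos.mpr hd0).ne'
  have hbij : ∑ k ∈ d.divisors, (Nat.totient d : ℝ) / Nat.totient k = d := by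
    have h : ∀ k ∈ d.divisors, (Nat.totient d : ℝ) / Nat.totient k = Nat.totient (d / k) := by
      intro k hk
      obtain ⟨m, rfl⟩ := Nat.dvd_of_mem_divisors hk
      have hk0 : 0 < k := Nat.pos_of_mul_pos_right hd0
      have hφk : (Nat.totient k : ℝ) ≠ 0 := by exact_mod_cast (Nat.totient_pos.mpr hk0).ne'
      rw [Nat.totient_mul (Nat.squarefree_mul_iff.mp (hsq _ hd)).1, Nat.mul_div_cancel_left m hk0]
      push_cast
      field_simp
    rw [sum_congr rfl h, Nat.sum_div_divisors d fun k => (Nat.totient k : ℝ)]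
    exact_mod_cast Nat.sum_totient d
  calc (d : ℝ) * ∑ l ∈ D with d ∣ l, 1 / (Nat.totient l : ℝ)
      = ∑ x ∈ d.divisors ×ˢ D.filter (d ∣ ·),
          (Nat.totient d : ℝ) / Nat.totient x.1 * (1 / (Nat.totient x.2 : ℝ)) := by
        rw [sum_product]
        dsimp only
        rw [← sum_mul_sum, hbij]
    _ = ∑ x ∈ d.divisors ×ˢ D.filter (d ∣ ·), 1 / (Nat.totient (f x) : ℝ) := by
        refine sum_congr rfl fun x hx => ?_
        obtain ⟨k, m, hx1, hx2, hk, -, hcm, hkm, hfx⟩ := hspec x hx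
        rw [hfx, hx1, hx2, Nat.totient_mul hcm, Nat.totient_mul hkm]
        push_cast
        field_simp
    _ = ∑ l ∈ (d.divisors ×ˢ D.filter (d ∣ ·)).image f, 1 / (Nat.totient l : ℝ) :=
        (sum_image (f := fun l : ℕ => 1 / (Nat.totient l : ℝ)) hinj).symm
    _ ≤ selbergMass D := by
        refine sum_le_sum_of_subset_of_nonneg ?_ fun _ _ _ => by positivity
        intro l hl
        obtain ⟨x, hx, rfl⟩ := mem_image.mp hl
        obtain ⟨k, m, -, -, hk, hm, -, -, hfx⟩ := hspec x hx
        exact hdvd _ hm _ (hfx ▸ Nat.mul_dvd_mul_right hk m)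

theorem abs_selbergWeight_le_one (h1 : 1 ∈ D) (hsq : ∀ d ∈ D, Squarefree d)
    (hdvd : ∀ d ∈ D, ∀ e, e ∣ d → e ∈ D) {d : ℕ} (hd : d ∈ D) :
    |selbergWeight D d| ≤ 1 := by
  have hS := selbergMass_pos h1
  have hμ : |(ArithmeticFunction.moebius d : ℝ)| = 1 := by
    exact_mod_cast ArithmeticFunction.abs_moebius_eq_one_of_squarefree (hsq d hd)
  have hnn : (0 : ℝ) ≤ ∑ l ∈ D with d ∣ l, 1 / (Nat.totient l : ℝ) :=
    sum_nonneg fun _ _ => by positivity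
  rw [selbergWeight, abs_mul, abs_div, abs_mul, hμ, one_mul, abs_of_nonneg hnn, abs_of_pos hS,
    Nat.abs_cast, div_mul_eq_mul_div, div_le_one hS]
  exact mul_sum_filter_dvd_le_selbergMass hsq hdvd hd

/-- Selberg's upper bound sieve for a set `A` in which a proportion `1 / d` of the elements is
divisible by `d`, with an error of at most one element. -/
theorem selberg_sieve (h1 : 1 ∈ D) (hsq : ∀ d ∈ D, Squarefree d)
    (hdvd : ∀ d ∈ D, ∀ e, e ∣ d → e ∈ D) (A : Finset ℕ) (X : ℝ)
    (hA : ∀ a ∈ D, ∀ b ∈ D,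
      |((A.filter (a.lcm b ∣ ·)).card : ℝ) - X / (a.lcm b : ℕ)| ≤ 1) :
    ((A.filter fun n => ∀ d ∈ D, d ∣ n → d = 1).card : ℝ) ≤
      X / selbergMass D + (D.card : ℝ) ^ 2 := by
  set w := selbergWeight D with hw
  calc ((A.filter fun n => ∀ d ∈ D, d ∣ n → d = 1).card : ℝ)
      = ∑ n ∈ A with ∀ d ∈ D, d ∣ n → d = 1, (∑ d ∈ D with d ∣ n, w d) ^ 2 := by
        rw [card_eq_sum_ones]
        push_cast
        refine sum_congr rfl fun n hn => ?_
        have hset : D.filter (· ∣ n) = {1} := by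
          ext d
          simp only [mem_filter, mem_singleton]
          exact ⟨fun h => (mem_filter.mp hn).2 d h.1 h.2, fun h => h ▸ ⟨h1, one_dvd n⟩⟩
        rw [hset, sum_singleton, hw, selbergWeight_one h1, one_pow]
    _ ≤ ∑ n ∈ A, (∑ d ∈ D with d ∣ n, w d) ^ 2 :=
        sum_le_sum_of_subset_of_nonneg (filter_subset _ _) fun _ _ _ => sq_nonneg _
    _ = ∑ a ∈ D, ∑ b ∈ D, w a * w b * ((A.filter (a.lcm b ∣ ·)).card : ℝ) := by
        have hterm : ∀ n ∈ A, (∑ d ∈ D with d ∣ n, w d) ^ 2 =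
            ∑ a ∈ D, ∑ b ∈ D, if a.lcm b ∣ n then w a * w b else 0 := by
          intro n _
          rw [sq, sum_filter, sum_mul_sum]
          refine sum_congr rfl fun a _ => sum_congr rfl fun b _ => ?_
          by_cases ha : a ∣ n <;> by_cases hb : b ∣ n <;> simp [ha, hb, Nat.lcm_dvd_iff]
        rw [sum_congr rfl hterm, sum_comm]
        refine sum_congr rfl fun a _ => ?_
        rw [sum_comm]
        refine sum_congr rfl fun b _ => ?_
        rw [← sum_filter, sum_const, nsmul_eq_mul, mul_comm]
    _ ≤ ∑ a ∈ D, ∑ b ∈ D, (X * (w a * w b / (a.lcm b : ℕ)) + 1) := by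
        refine sum_le_sum fun a ha => sum_le_sum fun b hb => ?_
        have hab : |w a * w b| ≤ 1 := by
          rw [abs_mul]
          exact mul_le_one₀ (abs_selbergWeight_le_one h1 hsq hdvd ha) (abs_nonneg _)
            (abs_selbergWeight_le_one h1 hsq hdvd hb)
        have herr : |w a * w b * (((A.filter (a.lcm b ∣ ·)).card : ℝ) - X / (a.lcm b : ℕ))| ≤ 1 := by
          rw [abs_mul]
          exact mul_le_one₀ hab (abs_nonneg _) (hA a ha b hb)
        have := (abs_le.mp herr).2
        have hrw : X * (w a * w b / (a.lcm b : ℕ)) = w a * w b * (X / (a.lcm b : ℕ)) := by ring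
        rw [hrw]
        linarith
    _ = X / selbergMass D + (D.card : ℝ) ^ 2 := by
        simp_rw [sum_add_distrib, ← mul_sum]
        rw [hw, selberg_quadratic_form h1 hsq hdvd]
        simp only [sum_const, nsmul_eq_mul, mul_one]
        ring

end Selberg

theorem sum_inv_primeFactors_eq_le_inv_totient {d : ℕ} (hd : Squarefree d) (s : Finset ℕ)
    (hs : ∀ n ∈ s, n ≠ 0 ∧ n.primeFactors = d.primeFactors) :
    ∑ n ∈ s, 1 / (n : ℝ) ≤ 1 / (Nat.totient d : ℝ) := by
  classical
  have hd0 : 0 < d := Nat.pos_of_ne_zero hd.ne_zero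
  have hd0' : (0 : ℝ) < d := by exact_mod_cast hd0
  let f : ℕ →* ℝ := ⟨⟨fun n => 1 / (n : ℝ), by simp⟩, fun a b => by
    push_cast; exact (one_div_mul_one_div _ _).symm⟩
  have hf : ∀ {p : ℕ}, p.Prime → ‖f p‖ < 1 := fun {p} hp => by
    change ‖1 / (p : ℝ)‖ < 1
    rw [Real.norm_of_nonneg (by positivity), div_lt_one (by exact_mod_cast hp.pos)]
    exact_mod_cast hp.one_lt
  obtain ⟨-, hsum⟩ :=
    EulerProduct.summable_and_hasSum_factoredNumbers_prod_filter_prime_geometric hf d.primeFactors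
  have hprod : ∏ p ∈ d.primeFactors with p.Prime, (1 - f p)⁻¹ = d / (Nat.totient d : ℝ) := by
    have h := Nat.totient_eq_mul_prod_factors d
    have h' : (Nat.totient d : ℝ) = d * ∏ p ∈ d.primeFactors, (1 - (p : ℝ)⁻¹) := by
      simpa using congrArg (Rat.cast : ℚ → ℝ) h
    rw [Finset.filter_true_of_mem fun p hp => Nat.prime_of_mem_primeFactors hp,
      Finset.prod_inv_distrib, h']
    have : ∀ p ∈ d.primeFactors, 1 - f p = 1 - (p : ℝ)⁻¹ := fun p _ => by
      change 1 - 1 / (p : ℝ) = _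
      rw [one_div]
    rw [Finset.prod_congr rfl this]
    field_simp
  rw [hprod] at hsum
  have hdvd : ∀ n ∈ s, d ∣ n := fun n hn => by
    rw [← Nat.prod_primeFactors_of_squarefree hd, ← (hs n hn).2]
    exact Nat.prod_primeFactors_dvd n
  have hmem : ∀ n ∈ s, n / d ∈ Nat.factoredNumbers d.primeFactors := fun n hn => by
    obtain ⟨m, rfl⟩ := hdvd n hn
    rw [Nat.mul_div_cancel_left m hd0, Nat.mem_factoredNumbers]
    refine ⟨right_ne_zero_of_mul (hs _ hn).1, fun p hp => ?_⟩
    rw [← (hs _ hn).2]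
    exact Nat.mem_primeFactors.mpr ⟨Nat.prime_of_mem_primeFactorsList hp,
      (Nat.dvd_of_mem_primeFactorsList hp).mul_left d, (hs _ hn).1⟩
  have hle : ∑ n ∈ s, f (n / d) ≤ d / (Nat.totient d : ℝ) := by
    have himg : ∑ n ∈ s, f (n / d) =
        ∑ x ∈ s.attach.image (fun n => (⟨n.1 / d, hmem n.1 n.2⟩ :
          Nat.factoredNumbers d.primeFactors)), f x := by
      rw [Finset.sum_image, ← Finset.sum_attach]
      intro a _ b _ hab
      have h : a.1 / d = b.1 / d := congrArg Subtype.val hab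
      exact Subtype.ext ((Nat.div_left_inj (hdvd _ a.2) (hdvd _ b.2)).mp h)
    rw [himg]
    exact sum_le_hasSum _ (fun x _ => by change (0 : ℝ) ≤ 1 / ((x : ℕ) : ℝ); positivity) hsum
  have hterm : ∀ n ∈ s, 1 / (n : ℝ) = 1 / d * f (n / d) := fun n hn => by
    obtain ⟨m, rfl⟩ := hdvd n hn
    change _ = 1 / (d : ℝ) * (1 / ((d * m / d : ℕ) : ℝ))
    rw [Nat.mul_div_cancel_left m hd0]
    push_cast
    exact (one_div_mul_one_div _ _).symm
  rw [Finset.sum_congr rfl hterm, ← Finset.mul_sum]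
  calc 1 / (d : ℝ) * ∑ n ∈ s, f (n / d) ≤ 1 / d * (d / (Nat.totient d : ℝ)) := by gcongr
    _ = 1 / (Nat.totient d : ℝ) := by field_simp

/-- The squarefree numbers up to `z` coprime to `Q`. -/
def siftingDivisors (Q z : ℕ) : Finset ℕ :=
  (Finset.Icc 1 z).filter fun d => Squarefree d ∧ d.Coprime Q

theorem sum_inv_coprime_le_selbergMass (Q z : ℕ) :
    ∑ n ∈ Finset.Icc 1 z with n.Coprime Q, 1 / (n : ℝ) ≤ selbergMass (siftingDivisors Q z) := by
  classical
  have hmaps : ∀ n ∈ (Finset.Icc 1 z).filter (Nat.Coprime · Q),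
      ∏ p ∈ n.primeFactors, p ∈ siftingDivisors Q z := fun n hn => by
    simp only [Finset.mem_filter, Finset.mem_Icc] at hn
    have hdvd := Nat.prod_primeFactors_dvd n
    have hpos : 0 < ∏ p ∈ n.primeFactors, p := Nat.pos_of_dvd_of_pos hdvd hn.1.1
    simp only [siftingDivisors, Finset.mem_filter, Finset.mem_Icc]
    refine ⟨⟨hpos, (Nat.le_of_dvd hn.1.1 hdvd).trans hn.1.2⟩, ?_, hn.2.coprime_dvd_left hdvd⟩
    refine Finset.squarefree_prod_of_pairwise_isCoprime (fun p hp q hq hpq => ?_)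
      fun p hp => (Nat.prime_of_mem_primeFactors hp).squarefree
    exact Nat.coprime_iff_isRelPrime.mp ((Nat.coprime_primes (Nat.prime_of_mem_primeFactors hp)
      (Nat.prime_of_mem_primeFactors hq)).mpr hpq)
  rw [← Finset.sum_fiberwise_of_maps_to hmaps, selbergMass]
  refine Finset.sum_le_sum fun d hd => ?_
  have hsq : Squarefree d := (Finset.mem_filter.mp hd).2.1
  refine sum_inv_primeFactors_eq_le_inv_totient hsq _ fun n hn => ?_
  simp only [Finset.mem_filter, Finset.mem_Icc] at hn
  refine ⟨by omega, ?_⟩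
  rw [← hn.2, Nat.primeFactors_prod_primeFactors]

theorem log_le_selbergMass {Q z : ℕ} (hQ : Q ≠ 0) :
    (1 - ∑ q ∈ Q.primeFactors, 1 / (q : ℝ)) * Real.log (z + 1) ≤
      selbergMass (siftingDivisors Q z) := by
  classical
  set H : ℝ := ∑ n ∈ Finset.Icc 1 z, 1 / (n : ℝ) with hH
  have hlog : Real.log (z + 1) ≤ H := by
    have h := log_add_one_le_harmonic z
    rw [harmonic_eq_sum_Icc] at h
    push_cast at h
    simpa [hH] using h
  have hnot : ∑ n ∈ Finset.Icc 1 z with ¬ n.Coprime Q, 1 / (n : ℝ) ≤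
      (∑ q ∈ Q.primeFactors, 1 / (q : ℝ)) * H := by
    rw [hH, Finset.sum_mul_sum, ← Finset.sum_product']
    have hsub : (Finset.Icc 1 z).filter (fun n => ¬ n.Coprime Q) ⊆
        (Q.primeFactors ×ˢ Finset.Icc 1 z).image fun x => x.1 * x.2 := by
      intro n hn
      simp only [Finset.mem_filter, Finset.mem_Icc] at hn
      obtain ⟨p, hp, hpn, hpQ⟩ := Nat.Prime.not_coprime_iff_dvd.mp hn.2
      obtain ⟨m, rfl⟩ := hpn
      have hm : 0 < m := Nat.pos_of_ne_zero fun h => by simp [h] at hn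
      exact Finset.mem_image.mpr ⟨(p, m), Finset.mem_product.mpr
        ⟨Nat.mem_primeFactors.mpr ⟨hp, hpQ, hQ⟩, Finset.mem_Icc.mpr
          ⟨hm, (Nat.le_mul_of_pos_left m hp.pos).trans hn.1.2⟩⟩, rfl⟩
    refine (Finset.sum_le_sum_of_subset_of_nonneg hsub fun _ _ _ => by positivity).trans ?_
    refine (Finset.sum_image_le_of_nonneg (fun _ _ => by positivity)).trans (le_of_eq ?_)
    refine Finset.sum_congr rfl fun x _ => ?_
    push_cast
    exact (one_div_mul_one_div _ _).symm
  have hsplit := Finset.sum_filter_add_sum_filter_not (Finset.Icc 1 z) (Nat.Coprime · Q)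
    fun n => 1 / (n : ℝ)
  have hmass := sum_inv_coprime_le_selbergMass Q z
  have hmass0 : 0 ≤ selbergMass (siftingDivisors Q z) :=
    Finset.sum_nonneg fun _ _ => by positivity
  rcases le_total (1 - ∑ q ∈ Q.primeFactors, 1 / (q : ℝ)) 0 with h | h
  · exact (mul_nonpos_of_nonpos_of_nonneg h (Real.log_nonneg (by
      have : (0 : ℝ) ≤ z := by positivity
      linarith))).trans hmass0
  · refine (mul_le_mul_of_nonneg_left hlog h).trans ?_
    linarith

theorem abs_card_modEq_sub_le_one (N c : ℕ) {r : ℕ} (hr : 0 < r) :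
    |(((Finset.Ioc 0 N).filter (· ≡ c [MOD r])).card : ℝ) - N / r| ≤ 1 := by
  have h := Nat.Ioc_filter_modEq_card 0 N hr c
  have hr' : (0 : ℚ) < r := by exact_mod_cast hr
  have hmono : ⌊((0 : ℕ) - c : ℚ) / r⌋ ≤ ⌊((N : ℚ) - c) / r⌋ := by
    apply Int.floor_le_floor
    gcongr
    simp
  rw [max_eq_left (by linarith)] at h
  have hq : |(((Finset.Ioc 0 N).filter (· ≡ c [MOD r])).card : ℚ) - N / r| ≤ 1 := by
    have h' : (((Finset.Ioc 0 N).filter (· ≡ c [MOD r])).card : ℚ) =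
        ⌊((N : ℚ) - c) / r⌋ - ⌊((0 : ℕ) - c : ℚ) / r⌋ := by exact_mod_cast h
    have h1 := Int.floor_le (((N : ℚ) - c) / r)
    have h2 := Int.lt_floor_add_one (((N : ℚ) - c) / r)
    have h3 := Int.floor_le (((0 : ℕ) - c : ℚ) / r)
    have h4 := Int.lt_floor_add_one (((0 : ℕ) - c : ℚ) / r)
    have h5 : ((N : ℚ) - c) / r = N / r + ((0 : ℕ) - c : ℚ) / r := by push_cast; ring
    rw [h', abs_le]
    constructor <;> linarith
  have hreal := (Rat.cast_le (K := ℝ)).mpr hq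
  push_cast at hreal
  exact hreal

theorem abs_card_modEq_one_filter_dvd_sub_le_one (N : ℕ) {Q e : ℕ} (hQ : 0 < Q) (he : 0 < e)
    (hc : e.Coprime Q) :
    |((((Finset.Ioc 0 N).filter (· ≡ 1 [MOD Q])).filter (e ∣ ·)).card : ℝ) - N / Q / e| ≤ 1 := by
  obtain ⟨c, hcQ, hce⟩ := Nat.chineseRemainder hc.symm 1 0
  have hset : ((Finset.Ioc 0 N).filter (· ≡ 1 [MOD Q])).filter (e ∣ ·) =
      (Finset.Ioc 0 N).filter (· ≡ c [MOD (Q * e)]) := by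
    ext n
    simp only [Finset.mem_filter, and_assoc, ← Nat.modEq_zero_iff_dvd]
    rw [← Nat.modEq_and_modEq_iff_modEq_mul hc.symm]
    exact and_congr_right fun _ => and_congr ⟨fun h => h.trans hcQ.symm, fun h => h.trans hcQ⟩
      ⟨fun h => h.trans hce.symm, fun h => h.trans hce⟩
  have h := abs_card_modEq_sub_le_one N c (Nat.mul_pos hQ he)
  rw [hset, div_div]
  exact_mod_cast h

theorem card_primes_modEq_one_le (N : ℕ) {Q z : ℕ} (hQ : 0 < Q) (hz : 1 ≤ z) :
    (((Nat.primesLE N).filter fun p => Q ∣ p - 1).card : ℝ) ≤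
      N / Q / selbergMass (siftingDivisors Q z) + (z : ℝ) ^ 2 + z := by
  classical
  set D := siftingDivisors Q z with hD
  have hmem : ∀ d, d ∈ D ↔ (1 ≤ d ∧ d ≤ z) ∧ Squarefree d ∧ d.Coprime Q := fun d => by
    simp [hD, siftingDivisors]
  have h1 : 1 ∈ D := (hmem 1).mpr ⟨⟨le_rfl, hz⟩, squarefree_one, Nat.coprime_one_left Q⟩
  have hdvd : ∀ d ∈ D, ∀ e, e ∣ d → e ∈ D := fun d hd e hed => by
    obtain ⟨⟨hd1, hdz⟩, hsq, hc⟩ := (hmem d).mp hd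
    exact (hmem e).mpr ⟨⟨Nat.pos_of_dvd_of_pos hed hd1, (Nat.le_of_dvd hd1 hed).trans hdz⟩,
      hsq.squarefree_of_dvd hed, hc.coprime_dvd_left hed⟩
  have hsieve := selberg_sieve h1 (fun d hd => ((hmem d).mp hd).2.1) hdvd
    ((Finset.Ioc 0 N).filter (· ≡ 1 [MOD Q])) (N / Q) fun a ha b hb => by
      obtain ⟨⟨ha1, -⟩, -, hac⟩ := (hmem a).mp ha
      obtain ⟨⟨hb1, -⟩, -, hbc⟩ := (hmem b).mp hb
      exact abs_card_modEq_one_filter_dvd_sub_le_one N hQ (Nat.lcm_pos ha1 hb1)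
        ((Nat.Coprime.mul_left hac hbc).coprime_dvd_left (Nat.lcm_dvd_mul a b))
  have hDcard : (D.card : ℝ) ≤ z := by
    have h := Finset.card_filter_le (Finset.Icc 1 z) fun d => Squarefree d ∧ d.Coprime Q
    rw [Nat.card_Icc, Nat.add_sub_cancel] at h
    exact_mod_cast h
  have hsub : (Nat.primesLE N).filter (fun p => Q ∣ p - 1) ⊆
      (((Finset.Ioc 0 N).filter (· ≡ 1 [MOD Q])).filter fun n => ∀ d ∈ D, d ∣ n → d = 1) ∪
        Finset.Icc 1 z := by
    intro p hp
    simp only [Finset.mem_filter, Nat.mem_primesLE] at hp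
    obtain ⟨⟨hpN, hpp⟩, hpQ⟩ := hp
    simp only [Finset.mem_union, Finset.mem_filter, Finset.mem_Ioc, Finset.mem_Icc]
    rcases le_or_gt p z with h | h
    · exact Or.inr ⟨hpp.one_le, h⟩
    · refine Or.inl ⟨⟨⟨hpp.pos, hpN⟩, ((Nat.modEq_iff_dvd' hpp.one_le).mpr hpQ).symm⟩, ?_⟩
      intro d hd hdp
      exact ((Nat.dvd_prime hpp).mp hdp).resolve_right fun hdp' => by
        have := ((hmem d).mp hd).1.2
        omega
  have hcard := (Finset.card_le_card hsub).trans (Finset.card_union_le _ _)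
  rw [Nat.card_Icc, Nat.add_sub_cancel] at hcard
  have hcard' : (((Nat.primesLE N).filter fun p => Q ∣ p - 1).card : ℝ) ≤
      ((((Finset.Ioc 0 N).filter (· ≡ 1 [MOD Q])).filter fun n => ∀ d ∈ D, d ∣ n → d = 1).card : ℝ)
        + z := by exact_mod_cast hcard
  have hD2 : (D.card : ℝ) ^ 2 ≤ (z : ℝ) ^ 2 := by gcongr
  linarith

open Filter Topology Asymptotics in
/-- A Brun–Titchmarsh inequality for the residue class `1`, for moduli with no small prime
factors. -/
theorem brun_titchmarsh {K : ℝ} (hK : 2 < K) :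
    ∃ δ > 0, ∃ Y : ℝ, 1 < Y ∧ ∀ (T : ℝ) (Q : ℕ), 0 < Q → 0 ≤ T → Y ≤ T / Q →
      ∑ q ∈ Q.primeFactors, 1 / (q : ℝ) ≤ δ →
        (((Nat.primesLE ⌊T⌋₊).filter fun p => Q ∣ p - 1).card : ℝ) ≤
          K * (T / Q) / Real.log (T / Q) := by
  have hlim : Tendsto (fun δ : ℝ => 2 / (1 - δ) ^ 2 + δ) (𝓝[>] 0) (𝓝 2) := by
    have : ContinuousAt (fun δ : ℝ => 2 / (1 - δ) ^ 2 + δ) 0 := by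
      refine ContinuousAt.add (ContinuousAt.div continuousAt_const (by fun_prop) (by norm_num))
        continuousAt_id
    have h := this.tendsto
    norm_num at h
    exact h.mono_left nhdsWithin_le_nhds
  obtain ⟨δ, hδK, hδ0, hδ1⟩ := ((hlim.eventually (gt_mem_nhds hK)).and
    (Ioo_mem_nhdsGT (show (0 : ℝ) < 1 by norm_num))).exists
  have hsmall : ∀ᶠ y : ℝ in atTop, 2 * y ^ (1 - δ) ≤ δ * y / Real.log y := by
    have h := (isLittleO_log_rpow_atTop hδ0).bound (half_pos hδ0)
    filter_upwards [h, eventually_gt_atTop 1] with y hy hy1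
    have hlog := Real.log_pos hy1
    have hy0 : 0 < y := by linarith
    have hpow : 0 < y ^ δ := Real.rpow_pos_of_pos hy0 _
    rw [Real.norm_of_nonneg hlog.le, Real.norm_of_nonneg hpow.le] at hy
    rw [le_div_iff₀ hlog, Real.rpow_sub hy0, Real.rpow_one, mul_div_assoc', div_mul_eq_mul_div,
      div_le_iff₀ hpow]
    nlinarith
  obtain ⟨Y, hY⟩ := eventually_atTop.mp (hsmall.and (eventually_gt_atTop 1))
  refine ⟨δ, hδ0, max Y 2, lt_of_lt_of_le (by norm_num) (le_max_right _ _), ?_⟩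
  intro T Q hQ hT hTQ hsum
  obtain ⟨hy, hy1⟩ := hY _ ((le_max_left _ _).trans hTQ)
  set y : ℝ := T / Q with hydef
  have hy0 : 0 < y := by linarith
  have hlog := Real.log_pos hy1
  have hQ' : (0 : ℝ) < Q := by exact_mod_cast hQ
  set x : ℝ := y ^ ((1 - δ) / 2) with hx
  have hx1 : 1 ≤ x := Real.one_le_rpow hy1.le (by linarith)
  have hxsq : x ^ 2 = y ^ (1 - δ) := by
    rw [hx, ← Real.rpow_natCast, ← Real.rpow_mul hy0.le]
    norm_num
  have hz : 1 ≤ ⌊x⌋₊ := Nat.le_floor (by exact_mod_cast hx1)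
  have hzx : (⌊x⌋₊ : ℝ) ≤ x := Nat.floor_le (by linarith)
  have hmass : (1 - δ) ^ 2 / 2 * Real.log y ≤ selbergMass (siftingDivisors Q ⌊x⌋₊) := by
    refine le_trans ?_ (log_le_selbergMass hQ.ne')
    have h1 : (1 - δ) / 2 * Real.log y ≤ Real.log (⌊x⌋₊ + 1) := by
      rw [← Real.log_rpow hy0]
      exact Real.log_le_log (by positivity) (Nat.lt_floor_add_one x).le
    calc (1 - δ) ^ 2 / 2 * Real.log y = (1 - δ) * ((1 - δ) / 2 * Real.log y) := by ring
      _ ≤ (1 - ∑ q ∈ Q.primeFactors, 1 / (q : ℝ)) * Real.log (⌊x⌋₊ + 1) := by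
        have : 0 ≤ (1 - δ) / 2 * Real.log y := mul_nonneg (by linarith) hlog.le
        apply mul_le_mul (by linarith) h1 this (by linarith)
  have hm0 : 0 < (1 - δ) ^ 2 / 2 * Real.log y := by
    have : 0 < 1 - δ := by linarith
    positivity
  have hN : (⌊T⌋₊ : ℝ) / Q ≤ y := by
    rw [hydef]
    gcongr
    exact Nat.floor_le hT
  have hmain : (⌊T⌋₊ : ℝ) / Q / selbergMass (siftingDivisors Q ⌊x⌋₊) ≤
      2 / (1 - δ) ^ 2 * y / Real.log y := by
    refine (div_le_div₀ hy0.le hN hm0 hmass).trans (le_of_eq ?_)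
    have : (1 - δ) ≠ 0 := by linarith
    field_simp
  calc _ ≤ _ := card_primes_modEq_one_le ⌊T⌋₊ hQ hz
    _ ≤ 2 / (1 - δ) ^ 2 * y / Real.log y + x ^ 2 + x ^ 2 := by
      have h1 : (⌊x⌋₊ : ℝ) ^ 2 ≤ x ^ 2 := by gcongr
      have h2 : x ≤ x ^ 2 := by nlinarith
      linarith
    _ ≤ 2 / (1 - δ) ^ 2 * y / Real.log y + δ * y / Real.log y := by
      rw [hxsq]
      linarith
    _ = (2 / (1 - δ) ^ 2 + δ) * y / Real.log y := by ring
    _ ≤ K * y / Real.log y := by gcongr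

theorem log_factorial_eq_sum_primesLE (n : ℕ) :
    Real.log n.factorial =
      ∑ p ∈ Nat.primesLE n, (n.factorial.factorization p : ℝ) * Real.log p := by
  have h := Nat.prod_factorization_pow_eq_self n.factorial_ne_zero
  rw [Nat.prod_factorization_eq_prod_primeFactors] at h
  have hpf : n.factorial.primeFactors = Nat.primesLE n := by
    ext p
    rw [Nat.mem_primeFactors, Nat.mem_primesLE]
    exact ⟨fun hp => ⟨(hp.1.dvd_factorial).mp hp.2.1, hp.1⟩,
      fun hp => ⟨hp.2, hp.2.dvd_factorial.mpr hp.1, n.factorial_ne_zero⟩⟩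
  rw [hpf] at h
  conv_lhs => rw [← h]
  push_cast
  rw [Real.log_prod]
  · exact Finset.sum_congr rfl fun p _ => Real.log_pow _ _
  · intro p hp
    have := (Nat.mem_primesLE.mp hp).2.ne_zero
    positivity

theorem div_sub_one_le_factorization_factorial {n p : ℕ} (hp : p.Prime) :
    (n : ℝ) / p - 1 ≤ n.factorial.factorization p := by
  have h : n / p ≤ n.factorial.factorization p := by
    rw [Nat.factorization_factorial hp (b := Nat.log p n + 2) (by omega)]
    simpa using Finset.single_le_sum (f := fun i => n / p ^ i) (fun _ _ => Nat.zero_le _)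
      (Finset.mem_Ico.mpr ⟨le_rfl, by omega⟩ : 1 ∈ Finset.Ico 1 (Nat.log p n + 2))
  have h' : ((n / p : ℕ) : ℝ) ≤ n.factorial.factorization p := by exact_mod_cast h
  have hlt := Nat.lt_floor_add_one ((n : ℝ) / p)
  rw [Nat.floor_div_eq_div] at hlt
  linarith

theorem factorization_factorial_le_div {n p : ℕ} (hp : p.Prime) :
    (n.factorial.factorization p : ℝ) ≤ n / (p - 1) := by
  have := Fact.mk hp
  have h := sub_one_mul_padicValNat_factorial (p := p) n
  have hp1 : (1 : ℝ) < p := by exact_mod_cast hp.one_lt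
  rw [le_div_iff₀ (by linarith), Nat.factorization_def _ hp]
  have h' : (p - 1) * padicValNat p n.factorial ≤ n := by omega
  have hc : (((p - 1 : ℕ) : ℝ)) = p - 1 := by rw [Nat.cast_sub hp.one_le]; simp
  rw [mul_comm, ← hc]
  exact_mod_cast h'

theorem exists_sum_log_div_le :
    ∃ C : ℝ, ∀ s : Finset ℕ, (∀ p ∈ s, p.Prime) →
      ∑ p ∈ s, Real.log p * (1 / (p - 1) - 1 / p) ≤ C := by
  have hs : Summable fun n : ℕ => 4 * (1 / (n : ℝ) ^ (3 / 2 : ℝ)) :=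
    (Real.summable_one_div_nat_rpow.mpr (by norm_num)).mul_left 4
  refine ⟨∑' n : ℕ, 4 * (1 / (n : ℝ) ^ (3 / 2 : ℝ)), fun s hprime => ?_⟩
  refine le_trans (Finset.sum_le_sum fun p hp => ?_)
    (hs.sum_le_tsum s fun _ _ => by positivity)
  have hp2 : (2 : ℝ) ≤ p := by exact_mod_cast (hprime p hp).two_le
  have hp0 : (0 : ℝ) < p := by linarith
  have hlog : Real.log p ≤ 2 * p ^ (1 / 2 : ℝ) := by
    have := Real.log_le_rpow_div hp0.le (show (0 : ℝ) < 1 / 2 by norm_num)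
    linarith
  have hinv : 1 / ((p : ℝ) - 1) - 1 / p ≤ 2 / p ^ 2 := by
    rw [div_sub_div _ _ (by linarith) hp0.ne', div_le_div_iff₀ (by nlinarith) (by positivity)]
    nlinarith
  have hinv0 : 0 ≤ 1 / ((p : ℝ) - 1) - 1 / p := by
    rw [sub_nonneg]
    exact one_div_le_one_div_of_le (by linarith) (by linarith)
  calc Real.log p * (1 / (p - 1) - 1 / p) ≤ 2 * p ^ (1 / 2 : ℝ) * (2 / p ^ 2) := by gcongr
    _ = 4 * (1 / (p : ℝ) ^ (3 / 2 : ℝ)) := by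
      have : (p : ℝ) ^ 2 = (p : ℝ) ^ (1 / 2 : ℝ) * (p : ℝ) ^ (3 / 2 : ℝ) := by
        rw [← Real.rpow_add hp0, ← Real.rpow_natCast]
        norm_num
      have h1 : (p : ℝ) ^ (1 / 2 : ℝ) ≠ 0 := (Real.rpow_pos_of_pos hp0 _).ne'
      have h2 : (p : ℝ) ^ (3 / 2 : ℝ) ≠ 0 := (Real.rpow_pos_of_pos hp0 _).ne'
      rw [this]
      field_simp
      norm_num

/-- Mertens' first theorem. -/
theorem mertens_first :
    ∃ C : ℝ, ∀ n : ℕ, 1 ≤ n →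
      |∑ p ∈ Nat.primesLE n, Real.log p / p - Real.log n| ≤ C := by
  obtain ⟨C, hC⟩ := exists_sum_log_div_le
  refine ⟨max (C + 1) (Real.log 4), fun n hn => ?_⟩
  have hn0 : (0 : ℝ) < n := by exact_mod_cast hn
  have hprime : ∀ p ∈ Nat.primesLE n, p.Prime := fun p hp => (Nat.mem_primesLE.mp hp).2
  have hlog0 : ∀ p : ℕ, 0 ≤ Real.log p := Real.log_natCast_nonneg
  have hfac_le : Real.log n.factorial ≤ n * Real.log n := by
    rw [← Real.log_pow]
    exact Real.log_le_log (by exact_mod_cast n.factorial_pos) (by exact_mod_cast n.factorial_le_pow)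
  have hfac_ge : n * Real.log n - n ≤ Real.log n.factorial := by
    have h := Real.pow_div_factorial_le_exp (n : ℝ) hn0.le n
    have h' := Real.log_le_log (by positivity) h
    rw [Real.log_div (by positivity) (by positivity), Real.log_pow, Real.log_exp] at h'
    linarith
  have hupper : n * ∑ p ∈ Nat.primesLE n, Real.log p / p - Real.log 4 * n ≤
      Real.log n.factorial := by
    have hθ := Chebyshev.theta_le_log4_mul_x hn0.le
    rw [Chebyshev.theta_eq_sum_primesLE_log] at hθ
    rw [log_factorial_eq_sum_primesLE, Finset.mul_sum]
    have : ∑ p ∈ Nat.primesLE n, (n : ℝ) * (Real.log p / p) - ∑ p ∈ Nat.primesLE n, Real.log p ≤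
        ∑ p ∈ Nat.primesLE n, (n.factorial.factorization p : ℝ) * Real.log p := by
      rw [← Finset.sum_sub_distrib]
      refine Finset.sum_le_sum fun p hp => ?_
      have := mul_le_mul_of_nonneg_right
        (div_sub_one_le_factorization_factorial (n := n) (hprime p hp)) (hlog0 p)
      calc (n : ℝ) * (Real.log p / p) - Real.log p = (n / p - 1) * Real.log p := by ring
        _ ≤ _ := this
    linarith
  have hlower : Real.log n.factorial ≤ n * (∑ p ∈ Nat.primesLE n, Real.log p / p + C) := by
    have h := hC _ hprime
    have h' : Real.log n.factorial ≤ n * (∑ p ∈ Nat.primesLE n, Real.log p / p +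
        ∑ p ∈ Nat.primesLE n, Real.log p * (1 / (p - 1) - 1 / p)) := by
      rw [log_factorial_eq_sum_primesLE, ← Finset.sum_add_distrib, Finset.mul_sum]
      refine Finset.sum_le_sum fun p hp => ?_
      have := mul_le_mul_of_nonneg_right
        (factorization_factorial_le_div (n := n) (hprime p hp)) (hlog0 p)
      calc _ ≤ _ := this
        _ = _ := by ring
    exact h'.trans (by gcongr)
  set S := ∑ p ∈ Nat.primesLE n, Real.log p / p
  have h1 : n * (S - Real.log n) ≤ n * Real.log 4 := by linarith
  have h2 : n * (Real.log n - S) ≤ n * (C + 1) := by linarith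
  have h3 := le_of_mul_le_mul_left h1 hn0
  have h4 := le_of_mul_le_mul_left h2 hn0
  exact abs_le.mpr ⟨by linarith [le_max_left (C + 1) (Real.log 4)],
    h3.trans (le_max_right _ _)⟩

/-- The primes `q` with `x ≤ q < y`. -/
noncomputable def primesBetween (x y : ℝ) : Finset ℕ :=
  (Finset.Ico ⌈x⌉₊ ⌈y⌉₊).filter Nat.Prime

theorem mem_primesBetween {x y : ℝ} {q : ℕ} :
    q ∈ primesBetween x y ↔ (x ≤ q ∧ (q : ℝ) < y) ∧ q.Prime := by
  simp only [primesBetween, Finset.mem_filter, Finset.mem_Ico, Nat.ceil_le, Nat.lt_ceil]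

theorem sum_primesBetween_add {x y z : ℝ} (hxy : x ≤ y) (hyz : y ≤ z) (f : ℕ → ℝ) :
    ∑ q ∈ primesBetween x y, f q + ∑ q ∈ primesBetween y z, f q =
      ∑ q ∈ primesBetween x z, f q := by
  simp only [primesBetween, Finset.sum_filter]
  exact Finset.sum_Ico_consecutive _ (Nat.ceil_mono hxy) (Nat.ceil_mono hyz)

theorem mertens_first_between :
    ∃ C : ℝ, ∀ x y : ℝ, 2 ≤ x → x ≤ y →
      |∑ q ∈ primesBetween x y, Real.log q / q - (Real.log y - Real.log x)| ≤ C := by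
  obtain ⟨C, hC⟩ := mertens_first
  have hone : ∀ x : ℝ, 2 ≤ x →
      |∑ q ∈ primesBetween 0 x, Real.log q / q - Real.log x| ≤ C + Real.log 2 := by
    intro x hx
    have hceil : 1 ≤ ⌈x⌉₊ - 1 := by
      have : 2 ≤ ⌈x⌉₊ := by exact_mod_cast hx.trans (Nat.le_ceil x)
      omega
    have hset : primesBetween 0 x = Nat.primesLE (⌈x⌉₊ - 1) := by
      ext q
      simp only [primesBetween, Nat.ceil_zero, Finset.mem_filter, Finset.mem_Ico,
        Nat.mem_primesLE]
      exact and_congr_left fun _ => by omega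
    have hm := hC _ hceil
    rw [hset]
    have hcast : ((⌈x⌉₊ - 1 : ℕ) : ℝ) = ⌈x⌉₊ - 1 := by
      rw [Nat.cast_sub (by omega)]; simp
    have h1 := Nat.ceil_lt_add_one (show 0 ≤ x by linarith)
    have h2 := Nat.le_ceil x
    have hle : Real.log ((⌈x⌉₊ - 1 : ℕ) : ℝ) ≤ Real.log x :=
      Real.log_le_log (by exact_mod_cast hceil) (by rw [hcast]; linarith)
    have hge : Real.log x - Real.log 2 ≤ Real.log ((⌈x⌉₊ - 1 : ℕ) : ℝ) := by
      rw [← Real.log_div (by linarith) (by norm_num)]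
      exact Real.log_le_log (by linarith) (by rw [hcast]; linarith)
    have := Real.log_pos one_lt_two
    rw [abs_le] at hm ⊢
    constructor <;> linarith
  refine ⟨2 * (C + Real.log 2), fun x y hx hxy => ?_⟩
  have h1 := abs_le.mp (hone x hx)
  have h2 := abs_le.mp (hone y (hx.trans hxy))
  have h3 := sum_primesBetween_add (by linarith : (0 : ℝ) ≤ x) hxy fun q => Real.log q / q
  rw [abs_le]
  constructor <;> linarith

open Filter Topology Asymptotics in
theorem eventually_mul_div_log_le_primeCounting {c : ℝ} (hc : c < Real.log 2) :
    ∀ᶠ T : ℝ in atTop, c * (T / Real.log T) ≤ (Nat.primeCounting ⌊T⌋₊ : ℝ) := by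
  have hε : 0 < (Real.log 2 - c) / 2 := by linarith
  have hlog := Real.isLittleO_log_id_atTop.bound hε
  filter_upwards [hlog, eventually_ge_atTop 2,
    eventually_ge_atTop (2 * (2 * Real.log 2) / (Real.log 2 - c))] with T hT hT2 hTbig
  have hl0 : 0 < Real.log T := Real.log_pos (by linarith)
  rw [Real.norm_of_nonneg hl0.le, id, Real.norm_of_nonneg (by linarith)] at hT
  have hlow := Chebyshev.psi_ge' (show 0 ≤ T by linarith)
  have hup := Chebyshev.psi_le_primeCounting_mul_log' T
  have hlog2 : Real.log (T + 2) ≤ Real.log 2 + Real.log T := by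
    rw [← Real.log_mul (by norm_num) (by linarith)]
    exact Real.log_le_log (by linarith) (by linarith)
  rw [div_le_iff₀ (by linarith)] at hTbig
  rw [mul_div_assoc', div_le_iff₀ hl0]
  linarith

theorem sum_inv_primesBetween_le {C α a b T : ℝ}
    (hC : ∀ x y : ℝ, 2 ≤ x → x ≤ y →
      |∑ q ∈ primesBetween x y, Real.log q / q - (Real.log y - Real.log x)| ≤ C)
    (hα : 0 < α) (hαa : α ≤ a) (hab : a ≤ b) (hT : 1 < T) (hTα : 2 ≤ T ^ α) :
    ∑ q ∈ primesBetween (T ^ a) (T ^ b), 1 / (q : ℝ) ≤ (b - a) / a + C / (α * Real.log T) := by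
  have hlog := Real.log_pos hT
  have hT0 : 0 < T := by linarith
  have ha : 0 < a := by linarith
  have hTa : 2 ≤ T ^ a := hTα.trans (Real.rpow_le_rpow_of_exponent_le hT.le hαa)
  have hmert := hC _ _ hTa (Real.rpow_le_rpow_of_exponent_le hT.le hab)
  have hC0 : 0 ≤ C := (abs_nonneg _).trans hmert
  have hmert := (abs_le.mp hmert).2
  rw [Real.log_rpow hT0, Real.log_rpow hT0] at hmert
  have hterm : ∀ q ∈ primesBetween (T ^ a) (T ^ b),
      1 / (q : ℝ) ≤ Real.log q / q / (a * Real.log T) := fun q hq => by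
    obtain ⟨⟨hq1, -⟩, hqp⟩ := mem_primesBetween.mp hq
    have hq0 : (0 : ℝ) < q := by exact_mod_cast hqp.pos
    have h := Real.log_le_log (by positivity) hq1
    rw [Real.log_rpow hT0] at h
    rw [div_div, div_le_div_iff₀ hq0 (by positivity)]
    nlinarith
  calc ∑ q ∈ primesBetween (T ^ a) (T ^ b), 1 / (q : ℝ)
      ≤ (∑ q ∈ primesBetween (T ^ a) (T ^ b), Real.log q / q) / (a * Real.log T) := by
        rw [Finset.sum_div]
        exact Finset.sum_le_sum hterm
    _ ≤ (b * Real.log T - a * Real.log T + C) / (a * Real.log T) := by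
        gcongr
        linarith
    _ = (b - a) / a + C / (a * Real.log T) := by field_simp
    _ ≤ (b - a) / a + C / (α * Real.log T) := by gcongr

open Filter Topology in
/-- The upper bound in Mertens' second theorem, on a logarithmic scale. -/
theorem eventually_sum_inv_primesBetween_le {α β δ : ℝ} (hα : 0 < α) (hαβ : α ≤ β) (hδ : 0 < δ) :
    ∀ᶠ T : ℝ in atTop,
      ∑ q ∈ primesBetween (T ^ α) (T ^ β), 1 / (q : ℝ) ≤ Real.log (β / α) + δ := by
  obtain ⟨C, hC⟩ := mertens_first_between
  set L := Real.log (β / α) with hL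
  have hL0 : 0 ≤ L := Real.log_nonneg ((one_le_div hα).mpr hαβ)
  obtain ⟨J, hJ⟩ := exists_nat_gt (max (L ^ 2 / (δ / 2)) (max L 1))
  have hJ1 : 1 < (J : ℝ) := (le_max_right _ _).trans_lt ((le_max_right _ _).trans_lt hJ)
  have hJL : L < J := (le_max_left _ _).trans_lt ((le_max_right _ _).trans_lt hJ)
  have hJL2 : L ^ 2 / (δ / 2) < J := (le_max_left _ _).trans_lt hJ
  have hJ0 : (0 : ℝ) < J := by linarith
  set r := Real.exp (L / J) with hr
  have hr1 : 1 ≤ r := Real.one_le_exp (by positivity)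
  have hrJ : α * r ^ J = β := by
    rw [hr, ← Real.exp_nat_mul, mul_div_cancel₀ _ hJ0.ne', hL,
      Real.exp_log (div_pos (by linarith) hα)]
    field_simp
  have hrsub : J * (r - 1) ≤ L + δ / 2 := by
    have hle : L / J ≤ 1 := (div_le_one hJ0).mpr hJL.le
    have h0 : 0 ≤ L / J := by positivity
    have h := Real.abs_exp_sub_one_sub_id_le (abs_le.mpr ⟨by linarith, hle⟩)
    have h' := (abs_le.mp h).2
    rw [div_lt_iff₀ (by linarith)] at hJL2
    calc J * (r - 1) ≤ J * (L / J + (L / J) ^ 2) := by gcongr; linarith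
      _ = L + L ^ 2 / J := by field_simp
      _ ≤ L + δ / 2 := by
        have : L ^ 2 / J ≤ δ / 2 := (div_le_iff₀ hJ0).mpr (by linarith)
        linarith
  have hlim : Tendsto (fun T : ℝ => J * (C / (α * Real.log T))) atTop (𝓝 0) := by
    have h := (Real.tendsto_log_atTop.const_mul_atTop hα).const_div_atTop C
    simpa using h.const_mul (J : ℝ)
  filter_upwards [eventually_gt_atTop 1, (tendsto_rpow_atTop hα).eventually_ge_atTop 2,
    hlim.eventually (gt_mem_nhds (half_pos hδ))] with T hT hTα hTlim
  have hind : ∀ i : ℕ, ∑ q ∈ primesBetween (T ^ α) (T ^ (α * r ^ i)), 1 / (q : ℝ) ≤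
      i * ((r - 1) + C / (α * Real.log T)) := by
    intro i
    induction i with
    | zero => simp [primesBetween]
    | succ i ih =>
      have hri : 1 ≤ r ^ i := one_le_pow₀ hr1
      have h1 : α ≤ α * r ^ i := le_mul_of_one_le_right hα.le hri
      have h2 : α * r ^ i ≤ α * r ^ (i + 1) := by
        gcongr
        omega
      rw [← sum_primesBetween_add (Real.rpow_le_rpow_of_exponent_le hT.le h1)
        (Real.rpow_le_rpow_of_exponent_le hT.le h2)]
      have h := sum_inv_primesBetween_le hC hα h1 h2 hT hTα
      have hq : (α * r ^ (i + 1) - α * r ^ i) / (α * r ^ i) = r - 1 := by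
        field_simp
        ring
      rw [hq] at h
      push_cast
      linarith
  have h := hind J
  rw [hrJ] at h
  linarith

open Filter Topology in
theorem eventually_sum_weight_div_primesBetween_le {α β δ : ℝ} (hα : 0 < α) (hαβ : α ≤ β)
    (hδ : 0 < δ) :
    ∀ᶠ T : ℝ in atTop,
      ∑ q ∈ primesBetween (T ^ α) (T ^ β), (1 - Real.log q / (β * Real.log T)) / (q : ℝ) ≤
        Real.log (β / α) - (1 - α / β) + δ := by
  obtain ⟨C, hC⟩ := mertens_first_between
  have hβ : 0 < β := by linarith
  have hlim : Tendsto (fun T : ℝ => C / (β * Real.log T)) atTop (𝓝 0) :=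
    (Real.tendsto_log_atTop.const_mul_atTop hβ).const_div_atTop C
  filter_upwards [eventually_gt_atTop 1, (tendsto_rpow_atTop hα).eventually_ge_atTop 2,
    hlim.eventually (gt_mem_nhds (half_pos hδ)),
    eventually_sum_inv_primesBetween_le hα hαβ (half_pos hδ)] with T hT hTα hTlim hinv
  have hlog := Real.log_pos hT
  have hT0 : 0 < T := by linarith
  have hm := (abs_le.mp (hC _ _ hTα (Real.rpow_le_rpow_of_exponent_le hT.le hαβ))).1
  rw [Real.log_rpow hT0, Real.log_rpow hT0] at hm
  have heq : ∑ q ∈ primesBetween (T ^ α) (T ^ β), (1 - Real.log q / (β * Real.log T)) / (q : ℝ) =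
      ∑ q ∈ primesBetween (T ^ α) (T ^ β), 1 / (q : ℝ) -
        (∑ q ∈ primesBetween (T ^ α) (T ^ β), Real.log q / q) / (β * Real.log T) := by
    rw [Finset.sum_div, ← Finset.sum_sub_distrib]
    exact Finset.sum_congr rfl fun q _ => by ring
  have hge : (β * Real.log T - α * Real.log T - C) / (β * Real.log T) ≤
      (∑ q ∈ primesBetween (T ^ α) (T ^ β), Real.log q / q) / (β * Real.log T) := by
    gcongr
    linarith
  have hrw : (β * Real.log T - α * Real.log T - C) / (β * Real.log T) =
      1 - α / β - C / (β * Real.log T) := by field_simp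
  rw [heq]
  linarith

open Filter Topology in
theorem eventually_card_primes_modEq_one_le {K α v : ℝ} (hK : 2 < K) (hα : 0 < α) (hv : v < 1) :
    ∀ᶠ T : ℝ in atTop, ∀ Q : ℕ, 0 < Q → (Q : ℝ) ≤ T ^ v → Q.primeFactors.card ≤ 2 →
      (∀ q ∈ Q.primeFactors, T ^ α ≤ (q : ℝ)) →
        (((Nat.primesLE ⌊T⌋₊).filter fun p => Q ∣ p - 1).card : ℝ) ≤
          K * (T / Real.log T) / (Q * (1 - Real.log Q / Real.log T)) := by
  obtain ⟨δ, hδ, Y, hY1, hY⟩ := brun_titchmarsh hK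
  have hlim : Tendsto (fun T : ℝ => 2 / T ^ α) atTop (𝓝 0) :=
    (tendsto_rpow_atTop hα).const_div_atTop 2
  filter_upwards [eventually_gt_atTop 1, hlim.eventually (gt_mem_nhds hδ),
    (tendsto_rpow_atTop (show 0 < 1 - v by linarith)).eventually_ge_atTop Y]
    with T hT hTδ hTY Q hQ hQv hcard hmin
  have hT0 : 0 < T := by linarith
  have hlog := Real.log_pos hT
  have hQ' : (0 : ℝ) < Q := by exact_mod_cast hQ
  have hTQ : Y ≤ T / Q := by
    rw [Real.rpow_sub hT0, Real.rpow_one] at hTY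
    exact hTY.trans (by gcongr)
  have hsum : ∑ q ∈ Q.primeFactors, 1 / (q : ℝ) ≤ δ := by
    have h : ∑ q ∈ Q.primeFactors, 1 / (q : ℝ) ≤ ∑ q ∈ Q.primeFactors, 1 / T ^ α :=
      Finset.sum_le_sum fun q hq => one_div_le_one_div_of_le (by positivity) (hmin q hq)
    rw [Finset.sum_const, nsmul_eq_mul] at h
    have h2 : (Q.primeFactors.card : ℝ) ≤ 2 := by exact_mod_cast hcard
    calc _ ≤ _ := h
      _ ≤ 2 * (1 / T ^ α) := by gcongr
      _ = 2 / T ^ α := by ring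
      _ ≤ δ := hTδ.le
  refine (hY T Q hQ hT0.le hTQ hsum).trans (le_of_eq ?_)
  have hl : Real.log (T / Q) = Real.log T * (1 - Real.log Q / Real.log T) := by
    rw [Real.log_div hT0.ne' hQ'.ne']
    field_simp
  have hpos : 0 < Real.log (T / Q) := Real.log_pos (hY1.trans_le hTQ)
  rw [hl] at hpos ⊢
  have h1 : 1 - Real.log Q / Real.log T ≠ 0 := right_ne_zero_of_mul hpos.ne'
  generalize 1 - Real.log Q / Real.log T = u at h1 ⊢
  field_simp

/-- The weight `1 - log q / (β log T)` of the prime `q`. -/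
noncomputable def primeWeight (β T : ℝ) (q : ℕ) : ℝ := 1 - Real.log q / (β * Real.log T)

/-- The total weight of the prime divisors of `p - 1` in `[T ^ α, T ^ β)`. -/
noncomputable def divisorWeight (α β T : ℝ) (p : ℕ) : ℝ :=
  ∑ q ∈ primesBetween (T ^ α) (T ^ β) with q ∣ p - 1, primeWeight β T q

theorem log_div_log_lt_of_mem_primesBetween {α β T : ℝ} {q : ℕ} (hT : 1 < T)
    (hq : q ∈ primesBetween (T ^ α) (T ^ β)) : Real.log q / Real.log T < β := by
  obtain ⟨⟨-, h⟩, hqp⟩ := mem_primesBetween.mp hq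
  have h' := Real.log_lt_log (by exact_mod_cast hqp.pos) h
  rw [Real.log_rpow (by linarith)] at h'
  exact (div_lt_iff₀ (Real.log_pos hT)).mpr h'

theorem log_div_log_nonneg {T : ℝ} (hT : 1 < T) (q : ℕ) : 0 ≤ Real.log q / Real.log T :=
  div_nonneg (Real.log_natCast_nonneg q) (Real.log_pos hT).le

theorem primeWeight_eq (β T : ℝ) (q : ℕ) :
    primeWeight β T q = 1 - Real.log q / Real.log T / β := by
  rw [primeWeight, div_div, mul_comm]

theorem primeWeight_nonneg {α β T : ℝ} {q : ℕ} (hβ : 0 < β) (hT : 1 < T)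
    (hq : q ∈ primesBetween (T ^ α) (T ^ β)) : 0 ≤ primeWeight β T q := by
  rw [primeWeight_eq, sub_nonneg, div_le_one hβ]
  exact (log_div_log_lt_of_mem_primesBetween hT hq).le

theorem primeWeight_le_one {β T : ℝ} (hβ : 0 < β) (hT : 1 < T) (q : ℕ) :
    primeWeight β T q ≤ 1 := by
  rw [primeWeight_eq]
  have := div_nonneg (log_div_log_nonneg hT q) hβ.le
  linarith

theorem ncard_large_prime_divisors_le {α β T : ℝ} (hβ : 0 < β) (hT : 1 < T) {p : ℕ}
    (hp : p.Prime) (hpT : (p : ℝ) ≤ T) :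
    (Set.ncard {q : ℕ | q.Prime ∧ q ∣ (p - 1) ∧ T ^ α ≤ (q : ℝ)} : ℝ) ≤
      1 / β + divisorWeight α β T p := by
  classical
  have hlog := Real.log_pos hT
  have hp1 : p - 1 ≠ 0 := by have := hp.two_le; omega
  set E : Finset ℕ := (p - 1).primeFactors.filter fun q : ℕ => T ^ α ≤ (q : ℝ) with hE
  have hset : {q : ℕ | q.Prime ∧ q ∣ (p - 1) ∧ T ^ α ≤ (q : ℝ)} = (E : Set ℕ) := by
    ext q
    simp [hE, hp1, and_assoc]
  rw [hset, Set.ncard_coe_finset]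
  have hsumlog : ∑ q ∈ E, Real.log q ≤ Real.log T := by
    calc ∑ q ∈ E, Real.log q ≤ ∑ q ∈ (p - 1).primeFactors, Real.log q :=
          Finset.sum_le_sum_of_subset_of_nonneg (Finset.filter_subset _ _)
            fun q _ _ => Real.log_natCast_nonneg q
      _ = Real.log ((∏ q ∈ (p - 1).primeFactors, q : ℕ) : ℝ) := by
          push_cast
          rw [Real.log_prod fun q hq => ?_]
          exact_mod_cast (Nat.prime_of_mem_primeFactors hq).ne_zero
      _ ≤ Real.log T := by
          have h := Nat.prod_primeFactors_dvd (p - 1)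
          have hpos := Nat.pos_of_dvd_of_pos h (Nat.pos_of_ne_zero hp1)
          have hle := (Nat.le_of_dvd (Nat.pos_of_ne_zero hp1) h).trans (Nat.sub_le p 1)
          exact Real.log_le_log (by exact_mod_cast hpos)
            (le_trans (by exact_mod_cast hle) hpT)
  have hweights : (E.card : ℝ) - 1 / β ≤ ∑ q ∈ E, primeWeight β T q := by
    have h : ∑ q ∈ E, primeWeight β T q = E.card - (∑ q ∈ E, Real.log q) / (β * Real.log T) := by
      simp [primeWeight, Finset.sum_sub_distrib, Finset.sum_div]
    have h2 : (∑ q ∈ E, Real.log q) / (β * Real.log T) ≤ 1 / β := by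
      rw [div_le_div_iff₀ (by positivity) hβ]
      nlinarith
    linarith
  have hfilter : ∑ q ∈ E, primeWeight β T q ≤ divisorWeight α β T p := by
    have hsub : (primesBetween (T ^ α) (T ^ β)).filter (· ∣ p - 1) ⊆ E := by
      intro q hq
      obtain ⟨hq1, hq2⟩ := Finset.mem_filter.mp hq
      obtain ⟨⟨h1, -⟩, h2⟩ := mem_primesBetween.mp hq1
      exact Finset.mem_filter.mpr ⟨Nat.mem_primeFactors.mpr ⟨h2, hq2, hp1⟩, h1⟩
    rw [divisorWeight, ← Finset.sum_sdiff hsub]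
    suffices ∑ q ∈ E \ (primesBetween (T ^ α) (T ^ β)).filter (· ∣ p - 1),
        primeWeight β T q ≤ 0 by linarith
    refine Finset.sum_nonpos fun q hq => ?_
    obtain ⟨hqE, hqn⟩ := Finset.mem_sdiff.mp hq
    obtain ⟨hqf, hqα⟩ := Finset.mem_filter.mp hqE
    obtain ⟨hqp, hqd, -⟩ := Nat.mem_primeFactors.mp hqf
    have hqβ : T ^ β ≤ q := by
      by_contra! h
      exact hqn (Finset.mem_filter.mpr ⟨mem_primesBetween.mpr ⟨⟨hqα, h⟩, hqp⟩, hqd⟩)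
    have hl := Real.log_le_log (Real.rpow_pos_of_pos (by linarith) β) hqβ
    rw [Real.log_rpow (by linarith)] at hl
    rw [primeWeight, sub_nonpos]
    exact (one_le_div (by positivity)).mpr hl
  linarith

theorem divisorWeight_nonneg {α β T : ℝ} (hβ : 0 < β) (hT : 1 < T) (p : ℕ) :
    0 ≤ divisorWeight α β T p :=
  Finset.sum_nonneg fun _ hq => primeWeight_nonneg hβ hT (Finset.mem_filter.mp hq).1

theorem sum_divisorWeight (α β T : ℝ) (s : Finset ℕ) :
    ∑ p ∈ s, divisorWeight α β T p =
      ∑ q ∈ primesBetween (T ^ α) (T ^ β),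
        primeWeight β T q * ((s.filter fun p => q ∣ p - 1).card : ℝ) := by
  simp only [divisorWeight, Finset.sum_filter]
  rw [Finset.sum_comm]
  refine Finset.sum_congr rfl fun q _ => ?_
  rw [← Finset.sum_filter, Finset.sum_const, nsmul_eq_mul, mul_comm]

theorem sum_divisorWeight_sq (α β T : ℝ) (s : Finset ℕ) :
    ∑ p ∈ s, divisorWeight α β T p ^ 2 =
      ∑ q ∈ primesBetween (T ^ α) (T ^ β), ∑ r ∈ primesBetween (T ^ α) (T ^ β),
        primeWeight β T q * primeWeight β T r *
          ((s.filter fun p => q ∣ p - 1 ∧ r ∣ p - 1).card : ℝ) := by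
  have hterm : ∀ p ∈ s, divisorWeight α β T p ^ 2 =
      ∑ q ∈ primesBetween (T ^ α) (T ^ β), ∑ r ∈ primesBetween (T ^ α) (T ^ β),
        if q ∣ p - 1 ∧ r ∣ p - 1 then primeWeight β T q * primeWeight β T r else 0 := by
    intro p _
    rw [divisorWeight, Finset.sum_filter, sq, Finset.sum_mul_sum]
    refine Finset.sum_congr rfl fun q _ => Finset.sum_congr rfl fun r _ => ?_
    by_cases h : q ∣ p - 1 <;> by_cases h' : r ∣ p - 1 <;> simp [h, h']
  rw [Finset.sum_congr rfl hterm, Finset.sum_comm]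
  refine Finset.sum_congr rfl fun q _ => ?_
  rw [Finset.sum_comm]
  refine Finset.sum_congr rfl fun r _ => ?_
  rw [← Finset.sum_filter, Finset.sum_const, nsmul_eq_mul, mul_comm]

open Filter in
theorem eventually_card_primes_dvd_le {K α β : ℝ} (hK : 2 < K) (hα : 0 < α) (hβ1 : β < 1) :
    ∀ᶠ T : ℝ in atTop, ∀ q ∈ primesBetween (T ^ α) (T ^ β),
      (((Nat.primesLE ⌊T⌋₊).filter fun p => q ∣ p - 1).card : ℝ) ≤
        K * (T / Real.log T) / (q * (1 - Real.log q / Real.log T)) := by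
  filter_upwards [eventually_card_primes_modEq_one_le hK hα hβ1] with T hT q hq
  obtain ⟨⟨hq1, hq2⟩, hqp⟩ := mem_primesBetween.mp hq
  refine hT q hqp.pos hq2.le ?_ ?_
  · simp [hqp.primeFactors]
  · simpa [hqp.primeFactors] using hq1

open Filter in
theorem eventually_card_primes_dvd_dvd_le {K α β : ℝ} (hK : 2 < K) (hα : 0 < α)
    (hβ1 : β < 1 / 2) :
    ∀ᶠ T : ℝ in atTop, ∀ q ∈ primesBetween (T ^ α) (T ^ β),
      ∀ r ∈ primesBetween (T ^ α) (T ^ β), q ≠ r →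
      (((Nat.primesLE ⌊T⌋₊).filter fun p => q ∣ p - 1 ∧ r ∣ p - 1).card : ℝ) ≤
        K * (T / Real.log T) /
          (q * r * (1 - Real.log q / Real.log T - Real.log r / Real.log T)) := by
  filter_upwards [eventually_gt_atTop 1,
    eventually_card_primes_modEq_one_le hK hα (show 2 * β < 1 by linarith)]
    with T hT1 hT q hq r hr hqr
  obtain ⟨⟨hq1, hq2⟩, hqp⟩ := mem_primesBetween.mp hq
  obtain ⟨⟨hr1, hr2⟩, hrp⟩ := mem_primesBetween.mp hr
  have hc : q.Coprime r := (Nat.coprime_primes hqp hrp).mpr hqr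
  have hpf : (q * r).primeFactors = {q, r} := by
    rw [hc.primeFactors_mul, hqp.primeFactors, hrp.primeFactors]
    rfl
  have h := hT (q * r) (Nat.mul_pos hqp.pos hrp.pos) (by
      rw [two_mul, Real.rpow_add (by linarith)]
      push_cast
      gcongr) (by rw [hpf]; exact Finset.card_le_two) (by simp [hpf, hq1, hr1])
  have hq0 : (q : ℝ) ≠ 0 := by exact_mod_cast hqp.ne_zero
  have hr0 : (r : ℝ) ≠ 0 := by exact_mod_cast hrp.ne_zero
  have hfilter : (Nat.primesLE ⌊T⌋₊).filter (fun p => q ∣ p - 1 ∧ r ∣ p - 1) =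
      (Nat.primesLE ⌊T⌋₊).filter fun p => q * r ∣ p - 1 :=
    Finset.filter_congr fun p _ => ⟨fun h => hc.mul_dvd_of_dvd_of_dvd h.1 h.2,
      fun h => ⟨(dvd_mul_right q r).trans h, (dvd_mul_left r q).trans h⟩⟩
  rw [hfilter]
  push_cast at h
  rwa [Real.log_mul hq0 hr0, add_div, ← sub_sub] at h

open Filter in
theorem eventually_sum_divisorWeight_le {α β t : ℝ} (hα : 0 < α) (hαβ : α ≤ β) (hβ1 : β < 1)
    (ht : 0 < t) :
    ∀ᶠ T : ℝ in atTop, ∑ p ∈ Nat.primesLE ⌊T⌋₊, divisorWeight α β T p ≤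
      (2 + t) * (Real.log (β / α) + t) * (T / Real.log T) := by
  have hβ : 0 < β := hα.trans_le hαβ
  filter_upwards [eventually_gt_atTop 1,
    eventually_card_primes_dvd_le (show 2 < 2 + t by linarith) hα hβ1,
    eventually_sum_inv_primesBetween_le hα hαβ ht] with T hT hcard hsum
  have hlog := Real.log_pos hT
  rw [sum_divisorWeight]
  calc _ ≤ ∑ q ∈ primesBetween (T ^ α) (T ^ β), (2 + t) * (T / Real.log T) * (1 / (q : ℝ)) := by
        refine Finset.sum_le_sum fun q hq => ?_
        have hq0 : (0 : ℝ) < q := by exact_mod_cast (mem_primesBetween.mp hq).2.pos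
        have hu0 := log_div_log_nonneg hT q
        have hu1 := log_div_log_lt_of_mem_primesBetween hT hq
        refine (mul_le_mul_of_nonneg_left (hcard q hq) (primeWeight_nonneg hβ hT hq)).trans ?_
        rw [primeWeight_eq]
        generalize Real.log q / Real.log T = u at hu0 hu1 ⊢
        have hu : 0 < 1 - u := by linarith
        have hw : 1 - u / β ≤ 1 - u := by
          have := le_div_self hu0 hβ hβ1.le
          linarith
        calc _ = (2 + t) * (T / Real.log T) * (1 / (q : ℝ)) * ((1 - u / β) / (1 - u)) := by
              field_simp
          _ ≤ _ := mul_le_of_le_one_right (by positivity) ((div_le_one hu).mpr hw)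
    _ = (2 + t) * (T / Real.log T) * ∑ q ∈ primesBetween (T ^ α) (T ^ β), 1 / (q : ℝ) := by
        rw [Finset.mul_sum]
    _ ≤ (2 + t) * (T / Real.log T) * (Real.log (β / α) + t) := by gcongr
    _ = _ := by ring

open Filter in
theorem eventually_sum_divisorWeight_le' {α β t : ℝ} (hα : 0 < α) (hαβ : α ≤ β) (hβ1 : β < 1)
    (ht : 0 < t) :
    ∀ᶠ T : ℝ in atTop, ∑ p ∈ Nat.primesLE ⌊T⌋₊, divisorWeight α β T p ≤
      (2 + t) * (Real.log (β / α) - (1 - α / β) + t) / (1 - β) * (T / Real.log T) := by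
  have hβ : 0 < β := hα.trans_le hαβ
  have hβ1' : 0 < 1 - β := by linarith
  filter_upwards [eventually_gt_atTop 1,
    eventually_card_primes_dvd_le (show 2 < 2 + t by linarith) hα hβ1,
    eventually_sum_weight_div_primesBetween_le hα hαβ ht] with T hT hcard hsum
  have hlog := Real.log_pos hT
  rw [sum_divisorWeight]
  calc _ ≤ ∑ q ∈ primesBetween (T ^ α) (T ^ β),
          (2 + t) / (1 - β) * (T / Real.log T) * ((1 - Real.log q / (β * Real.log T)) / q) := by
        refine Finset.sum_le_sum fun q hq => ?_
        have hq0 : (0 : ℝ) < q := by exact_mod_cast (mem_primesBetween.mp hq).2.pos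
        have hu1 := log_div_log_lt_of_mem_primesBetween hT hq
        have hw := primeWeight_nonneg hβ hT hq
        refine (mul_le_mul_of_nonneg_left (hcard q hq) hw).trans ?_
        rw [primeWeight] at hw ⊢
        generalize 1 - Real.log q / (β * Real.log T) = w at hw ⊢
        calc _ ≤ w * ((2 + t) * (T / Real.log T) / (q * (1 - β))) := by gcongr
          _ = _ := by field_simp
    _ = (2 + t) / (1 - β) * (T / Real.log T) * ∑ q ∈ primesBetween (T ^ α) (T ^ β),
          (1 - Real.log q / (β * Real.log T)) / q := by rw [Finset.mul_sum]
    _ ≤ (2 + t) / (1 - β) * (T / Real.log T) * (Real.log (β / α) - (1 - α / β) + t) := by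
        gcongr
    _ = _ := by ring

theorem one_sub_div_mul_one_sub_div_le {β u v : ℝ} (hβ : 0 < β) (hβ1 : β ≤ 1 / 2)
    (hu : 0 ≤ u) (hv : 0 ≤ v) (huβ : u ≤ β) (hvβ : v ≤ β) :
    (1 - u / β) * (1 - v / β) ≤ 1 - u - v := by
  obtain ⟨a, rfl⟩ : ∃ a, u = β * a := ⟨u / β, by field_simp⟩
  obtain ⟨b, rfl⟩ : ∃ b, v = β * b := ⟨v / β, by field_simp⟩
  have ha : 0 ≤ a := nonneg_of_mul_nonneg_right hu hβ
  have hb : 0 ≤ b := nonneg_of_mul_nonneg_right hv hβ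
  have ha1 : a ≤ 1 := by nlinarith
  have hb1 : b ≤ 1 := by nlinarith
  rw [mul_div_cancel_left₀ _ hβ.ne', mul_div_cancel_left₀ _ hβ.ne']
  nlinarith [mul_nonneg ha (sub_nonneg.mpr hb1), mul_nonneg hb (sub_nonneg.mpr ha1),
    mul_nonneg (add_nonneg ha hb) (sub_nonneg.mpr hβ1)]

open Filter in
theorem eventually_sum_divisorWeight_sq_le {α β t : ℝ} (hα : 0 < α) (hαβ : α ≤ β)
    (hβ1 : β < 1 / 2) (ht : 0 < t) :
    ∀ᶠ T : ℝ in atTop, ∑ p ∈ Nat.primesLE ⌊T⌋₊, divisorWeight α β T p ^ 2 ≤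
      (2 + t) * ((Real.log (β / α) + t) ^ 2 + (Real.log (β / α) + t)) * (T / Real.log T) := by
  have hβ : 0 < β := hα.trans_le hαβ
  filter_upwards [eventually_gt_atTop 1,
    eventually_card_primes_dvd_le (show 2 < 2 + t by linarith) hα
      (show β < 1 by linarith),
    eventually_card_primes_dvd_dvd_le (show 2 < 2 + t by linarith) hα hβ1,
    eventually_sum_inv_primesBetween_le hα hαβ ht] with T hT hcard hcard2 hsum
  have hlog := Real.log_pos hT
  set P := primesBetween (T ^ α) (T ^ β) with hP
  set M := T / Real.log T with hM
  have hM0 : 0 ≤ M := by positivity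
  have hS0 : 0 ≤ ∑ q ∈ P, 1 / (q : ℝ) := Finset.sum_nonneg fun q _ => by positivity
  rw [sum_divisorWeight_sq]
  have hpair : ∀ q ∈ P, ∀ r ∈ P, primeWeight β T q * primeWeight β T r *
      (((Nat.primesLE ⌊T⌋₊).filter fun p => q ∣ p - 1 ∧ r ∣ p - 1).card : ℝ) ≤
        (2 + t) * M * (1 / q * (1 / r) + if q = r then 1 / (q : ℝ) else 0) := by
    intro q hq r hr
    have hq0 : (0 : ℝ) < q := by exact_mod_cast (mem_primesBetween.mp hq).2.pos
    have hr0 : (0 : ℝ) < r := by exact_mod_cast (mem_primesBetween.mp hr).2.pos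
    have hu0 := log_div_log_nonneg hT q
    have hv0 := log_div_log_nonneg hT r
    have hu1 := log_div_log_lt_of_mem_primesBetween hT hq
    have hv1 := log_div_log_lt_of_mem_primesBetween hT hr
    have hw := mul_nonneg (primeWeight_nonneg hβ hT hq) (primeWeight_nonneg hβ hT hr)
    by_cases hqr : q = r
    · subst hqr
      simp only [and_self, if_true]
      refine (mul_le_mul_of_nonneg_left (hcard q hq) hw).trans ?_
      have hw' : primeWeight β T q * primeWeight β T q ≤ 1 - Real.log q / Real.log T := by
        refine (mul_le_of_le_one_right (primeWeight_nonneg hβ hT hq)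
          (primeWeight_le_one hβ hT q)).trans ?_
        have := le_div_self hu0 hβ (by linarith)
        rw [primeWeight_eq]
        linarith
      generalize Real.log q / Real.log T = u at hu0 hu1 hw' ⊢
      generalize primeWeight β T q * primeWeight β T q = w at hw hw' ⊢
      have hu : 0 < 1 - u := by linarith
      calc _ = (2 + t) * M * (1 / (q : ℝ)) * (w / (1 - u)) := by field_simp
        _ ≤ (2 + t) * M * (1 / (q : ℝ)) :=
            mul_le_of_le_one_right (by positivity) ((div_le_one hu).mpr hw')
        _ ≤ _ := by
            gcongr
            exact le_add_of_nonneg_left (by positivity)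
    · rw [if_neg hqr, add_zero]
      refine (mul_le_mul_of_nonneg_left (hcard2 q hq r hr hqr) hw).trans ?_
      have hw' : primeWeight β T q * primeWeight β T r ≤
          1 - Real.log q / Real.log T - Real.log r / Real.log T := by
        rw [primeWeight_eq, primeWeight_eq]
        exact one_sub_div_mul_one_sub_div_le hβ hβ1.le hu0 hv0 hu1.le hv1.le
      have hd : 0 < 1 - Real.log q / Real.log T - Real.log r / Real.log T := by linarith
      generalize 1 - Real.log q / Real.log T - Real.log r / Real.log T = d at hd hw' ⊢
      generalize primeWeight β T q * primeWeight β T r = w at hw hw' ⊢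
      calc _ = (2 + t) * M * (1 / (q : ℝ) * (1 / r)) * (w / d) := by field_simp
        _ ≤ _ := mul_le_of_le_one_right (by positivity) ((div_le_one hd).mpr hw')
  calc _ ≤ ∑ q ∈ P, ∑ r ∈ P,
          (2 + t) * M * (1 / q * (1 / r) + if q = r then 1 / (q : ℝ) else 0) :=
        Finset.sum_le_sum fun q hq => Finset.sum_le_sum fun r hr => hpair q hq r hr
    _ = (2 + t) * M * ((∑ q ∈ P, 1 / (q : ℝ)) ^ 2 + ∑ q ∈ P, 1 / (q : ℝ)) := by
        simp_rw [← Finset.mul_sum, Finset.sum_add_distrib]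
        rw [sq, Finset.sum_mul_sum]
        congr 2
        exact Finset.sum_congr rfl fun q hq => by simp [hq]
    _ ≤ (2 + t) * M * ((Real.log (β / α) + t) ^ 2 + (Real.log (β / α) + t)) := by gcongr
    _ = _ := by ring

open Filter Topology in
theorem eventually_le_mul_primeCounting {c ε : ℝ} (hc : 0 < c) (hε : 0 < ε)
    {N : ℝ → ℝ} {G : ℝ → ℝ} (hG : ContinuousAt G 0) (hG0 : G 0 ≤ Real.log 2 * c)
    (hN : ∀ t > 0, ∀ᶠ T : ℝ in atTop, N T ≤ G t * (T / Real.log T)) :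
    ∀ᶠ T : ℝ in atTop, N T ≤ (c + ε) * (Nat.primeCounting ⌊T⌋₊ : ℝ) := by
  have hlog2 : 0 < Real.log 2 := Real.log_pos (by norm_num)
  have hH : ContinuousAt (fun t => (c + ε) * (Real.log 2 - t) - G t) 0 := by fun_prop
  have hpos : 0 < (c + ε) * (Real.log 2 - 0) - G 0 := by nlinarith
  obtain ⟨t, htH, ht⟩ := (((hH.eventually (lt_mem_nhds hpos)).filter_mono
    nhdsWithin_le_nhds).and (self_mem_nhdsWithin (s := Set.Ioi (0 : ℝ)))).exists
  filter_upwards [eventually_gt_atTop 1, hN t ht,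
    eventually_mul_div_log_le_primeCounting (sub_lt_self (Real.log 2) ht)] with T hT hNT hπ
  have hlog := Real.log_pos hT
  calc N T ≤ G t * (T / Real.log T) := hNT
    _ ≤ ((c + ε) * (Real.log 2 - t)) * (T / Real.log T) := by
        gcongr
        linarith
    _ = (c + ε) * ((Real.log 2 - t) * (T / Real.log T)) := by ring
    _ ≤ _ := by gcongr

theorem card_filter_lt_mul_le_sum {ι : Type*} (s : Finset ι) {f : ι → ℝ} {V : ℝ}
    (hf : ∀ i ∈ s, 0 ≤ f i) :
    ((s.filter fun i => V < f i).card : ℝ) * V ≤ ∑ i ∈ s, f i := by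
  calc _ = ∑ i ∈ s with V < f i, V := by rw [Finset.sum_const, nsmul_eq_mul]
    _ ≤ ∑ i ∈ s with V < f i, f i :=
        Finset.sum_le_sum fun i hi => (Finset.mem_filter.mp hi).2.le
    _ ≤ _ := Finset.sum_le_sum_of_subset_of_nonneg (Finset.filter_subset _ _)
        fun i hi _ => hf i hi

theorem card_filter_lt_mul_sq_le_sum_sq {ι : Type*} (s : Finset ι) {f : ι → ℝ} {V : ℝ}
    (hV : 0 ≤ V) :
    ((s.filter fun i => V < f i).card : ℝ) * V ^ 2 ≤ ∑ i ∈ s, f i ^ 2 := by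
  have h : s.filter (fun i => V < f i) ⊆ s.filter fun i => V ^ 2 < f i ^ 2 :=
    Finset.monotone_filter_right _ fun i _ hi => pow_lt_pow_left₀ hi hV two_ne_zero
  refine le_trans ?_ (card_filter_lt_mul_le_sum (V := V ^ 2) s fun i _ => sq_nonneg (f i))
  gcongr

theorem exp_neg_le_one_sub_mul {x : ℝ} (hx0 : 0 ≤ x) (hx : x ≤ 2.7) :
    Real.exp (-x) ≤ 1 - (1 - Real.log 2) * x := by
  have hlog := Real.log_two_gt_d9
  have he : Real.exp (-2.7) ≤ 1 / 7 := by
    have h1 : Real.exp (-2.7) ≤ (Real.exp 1 ^ 2)⁻¹ := by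
      rw [← Real.exp_nat_mul, ← Real.exp_neg]
      exact Real.exp_le_exp.mpr (by norm_num)
    refine h1.trans ?_
    rw [one_div]
    have := Real.exp_one_gt_d9
    exact inv_anti₀ (by norm_num) (by nlinarith)
  have hconv := convexOn_exp.2 (Set.mem_univ (0 : ℝ)) (Set.mem_univ (-2.7 : ℝ))
    (show 0 ≤ 1 - x / 2.7 by rw [sub_nonneg]; exact (div_le_one (by norm_num)).mpr hx)
    (show 0 ≤ x / 2.7 by positivity) (by ring)
  simp only [smul_eq_mul, mul_zero, zero_add, Real.exp_zero, mul_one] at hconv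
  have hneg : x / 2.7 * (-2.7 : ℝ) = -x := by ring
  rw [hneg] at hconv
  nlinarith [div_nonneg hx0 (show (0 : ℝ) ≤ 2.7 by norm_num),
    div_mul_cancel₀ x (show (2.7 : ℝ) ≠ 0 by norm_num)]

open Filter in
theorem eventually_card_lt_divisorWeight_le {α β lam ε : ℝ} (hα : 0 < α) (hαβ : α < β)
    (hβ1 : β < 1) (hlam : 1 ≤ lam) (hε : 0 < ε) :
    ∀ᶠ T : ℝ in atTop, (((Nat.primesLE ⌊T⌋₊).filter fun p =>
        2 * lam * Real.log (β / α) / (1 - β) < divisorWeight α β T p).card : ℝ) ≤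
      (1 / lam + ε) * (Nat.primeCounting ⌊T⌋₊ : ℝ) := by
  have hβ : 0 < β := hα.trans hαβ
  have hlam0 : 0 < lam := by linarith
  have hβ' : 0 < 1 - β := by linarith
  have hlog2 := Real.log_two_gt_d9
  set L := Real.log (β / α) with hLdef
  have hL : 0 < L := Real.log_pos ((one_lt_div hα).mpr hαβ)
  have hLexp : α / β = Real.exp (-L) := by
    rw [Real.exp_neg, Real.exp_log (by positivity), inv_div]
  set V := 2 * lam * L / (1 - β) with hVdef
  have hV : 0 < V := by positivity
  by_cases hβlog : 1 - β ≤ Real.log 2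
  · refine eventually_le_mul_primeCounting (G := fun t => (2 + t) * (L + t) / V)
      (by positivity) hε (by fun_prop) ?_ fun t ht => ?_
    · have : (2 + 0) * (L + 0) / V = (1 - β) * (1 / lam) := by
        rw [hVdef]
        field_simp
        ring
      simp only [this]
      gcongr
    · filter_upwards [eventually_gt_atTop 1, eventually_sum_divisorWeight_le hα hαβ.le hβ1 ht]
        with T hT hsum
      rw [div_mul_eq_mul_div, le_div_iff₀ hV]
      exact (card_filter_lt_mul_le_sum _ fun p _ => divisorWeight_nonneg hβ hT p).trans hsum
  rw [not_le] at hβlog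
  rcases le_total L 2.7 with hL27 | hL27
  · refine eventually_le_mul_primeCounting
      (G := fun t => (2 + t) * (L - (1 - α / β) + t) / (1 - β) / V)
      (by positivity) hε (by fun_prop) ?_ fun t ht => ?_
    · have : (2 + 0) * (L - (1 - α / β) + 0) / (1 - β) / V =
          (L - (1 - α / β)) / L * (1 / lam) := by
        rw [hVdef]
        generalize α / β = x
        field_simp
        ring
      simp only [this]
      gcongr
      rw [div_le_iff₀ hL, hLexp]
      linarith [exp_neg_le_one_sub_mul hL.le hL27]
    · filter_upwards [eventually_gt_atTop 1, eventually_sum_divisorWeight_le' hα hαβ.le hβ1 ht]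
        with T hT hsum
      rw [div_mul_eq_mul_div, le_div_iff₀ hV]
      exact (card_filter_lt_mul_le_sum _ fun p _ => divisorWeight_nonneg hβ hT p).trans hsum
  · refine eventually_le_mul_primeCounting
      (G := fun t => (2 + t) * ((L + t) ^ 2 + (L + t)) / V ^ 2)
      (by positivity) hε (by fun_prop) ?_ fun t ht => ?_
    · have : (2 + 0) * ((L + 0) ^ 2 + (L + 0)) / V ^ 2 =
          (1 + 1 / L) / 2 * ((1 - β) ^ 2 * (1 / lam)) * (1 / lam) := by
        rw [hVdef]
        field_simp
        ring
      simp only [this]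
      gcongr
      have h1 : 1 / L ≤ 1 / 2.7 := by gcongr
      have h2 : (1 - β) ^ 2 * (1 / lam) ≤ 1 :=
        mul_le_one₀ (pow_le_one₀ hβ'.le (by linarith)) (by positivity)
          ((div_le_one hlam0).mpr hlam)
      calc (1 + 1 / L) / 2 * ((1 - β) ^ 2 * (1 / lam)) ≤ (1 + 1 / 2.7) / 2 * 1 := by gcongr
        _ ≤ Real.log 2 := by norm_num at hlog2 ⊢; linarith
    · filter_upwards [eventually_sum_divisorWeight_sq_le hα hαβ.le (by linarith) ht] with T hsum
      rw [div_mul_eq_mul_div, le_div_iff₀ (by positivity)]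
      exact (card_filter_lt_mul_sq_le_sum_sq _ hV.le).trans hsum

theorem divisorWeight_self (α T : ℝ) (p : ℕ) : divisorWeight α α T p = 0 := by
  refine Finset.sum_eq_zero fun q hq => ?_
  obtain ⟨⟨h1, h2⟩, -⟩ := mem_primesBetween.mp (Finset.mem_filter.mp hq).1
  exact absurd h2 h1.not_gt

/-- Let `0 < α ≤ β < 1 ≤ λ`. For every `ε > 0` there is `T₀` such that for every
`T ≥ T₀`, the number of primes `p ≤ T` for which the number of prime divisors `q ≥ T^α` of
`p − 1` exceeds `2λ log(β/α)/(1−β) + 1/β` is at most `(1/λ + ε)·π(T)`. -/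
theorem stmt13 (α β lam : ℝ) (hα : 0 < α) (hαβ : α ≤ β) (hβ : β < 1) (hlam : 1 ≤ lam) :
    ∀ ε : ℝ, 0 < ε → ∃ T₀ : ℝ, ∀ T : ℝ, T₀ ≤ T →
      (Set.ncard {p : ℕ | p.Prime ∧ (p : ℝ) ≤ T ∧
        ((Set.ncard {q : ℕ | q.Prime ∧ q ∣ (p - 1) ∧ T ^ α ≤ (q : ℝ)} : ℝ) >
          2 * lam * Real.log (β / α) / (1 - β) + 1 / β)} : ℝ)
      ≤ (1 / lam + ε) * (Set.ncard {p : ℕ | p.Prime ∧ (p : ℝ) ≤ T} : ℝ) := by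
  intro ε hε
  rw [← Filter.eventually_atTop]
  have hβ0 : 0 < β := hα.trans_le hαβ
  have key : ∀ᶠ T : ℝ in Filter.atTop, (((Nat.primesLE ⌊T⌋₊).filter fun p =>
        2 * lam * Real.log (β / α) / (1 - β) < divisorWeight α β T p).card : ℝ) ≤
      (1 / lam + ε) * (Nat.primeCounting ⌊T⌋₊ : ℝ) := by
    rcases hαβ.eq_or_lt with rfl | hlt
    · refine Filter.Eventually.of_forall fun T => ?_
      simp only [divisorWeight_self, div_self hα.ne', Real.log_one, mul_zero, zero_div, lt_irrefl,
        Finset.filter_false, Finset.card_empty, Nat.cast_zero]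
      positivity
    · exact eventually_card_lt_divisorWeight_le hα hlt hβ hlam hε
  filter_upwards [Filter.eventually_gt_atTop 1, key] with T hT hcard
  have hT0 : 0 ≤ T := by linarith
  have hπ : Set.ncard {p : ℕ | p.Prime ∧ (p : ℝ) ≤ T} = Nat.primeCounting ⌊T⌋₊ := by
    rw [← Nat.primesLE_card_eq_primeCounting, ← Set.ncard_coe_finset]
    congr 1
    ext p
    simp [Nat.mem_primesLE, Nat.le_floor_iff hT0, and_comm]
  rw [hπ]
  refine le_trans ?_ hcard
  rw [← Set.ncard_coe_finset]
  refine Nat.cast_le.mpr (Set.ncard_le_ncard ?_ (Finset.finite_toSet _))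
  rintro p ⟨hp, hpT, hgt⟩
  have h := ncard_large_prime_divisors_le (α := α) hβ0 hT hp hpT
  refine Finset.mem_coe.mpr (Finset.mem_filter.mpr
    ⟨Nat.mem_primesLE.mpr ⟨Nat.le_floor hpT, hp⟩, ?_⟩)
  linarith
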